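/- arXiv:1810.00122 — 2 statements merged into one kernel-verified Lean document; each statement's English description precedes it below -/
import Mathlib

section
/- Almost-sure convergence to global minimizers for ε_a = 1: Let ε_a = 1 and ε > 0. Then the set of initial values (a₀, w₀) ∈ ℝ × (ℝ^d \ {0}) for which the BNGD iterates (a_k, w_k) do NOT converge to a global minimizer of the BN-OLS objective (i.e., converge instead to a saddle point with a* = 0 and w*ᵀg = 0) has Lebesgue measure zero in ℝ^{1+d}. -/
open Matrix Filter Topology MeasureTheory

noncomputable section

namespace BNGD

/-- `T` is symmetric and bounded below by `m > 0` as a quadratic form. -/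
structure SymmCoercive {E : Type*} [NormedAddCommGroup E] [InnerProductSpace ℝ E]
    (T : E →L[ℝ] E) (m : ℝ) : Prop where
  pos : 0 < m
  symm : ∀ x y, inner ℝ (T x) y = inner ℝ x (T y)
  coercive : ∀ x, m * ‖x‖ ^ 2 ≤ inner ℝ x (T x)

section Defs

variable {E : Type*} [NormedAddCommGroup E] [InnerProductSpace ℝ E]

/-- The norm attached to the quadratic form of `T`. -/
def sigma (T : E →L[ℝ] E) (w : E) : ℝ := √(inner ℝ w (T w))

/-- The scale-invariant function `wᵀg / σ(w)`. -/
def phi (T : E →L[ℝ] E) (g w : E) : ℝ := inner ℝ w g / sigma T w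

/-- The gradient of `phi T g`. -/
def gradPhi (T : E →L[ℝ] E) (g w : E) : E :=
  (sigma T w)⁻¹ • (g - (inner ℝ w g / sigma T w ^ 2) • T w)

/-- One BNGD step with `ε_a = 1`. -/
def bnStep (T : E →L[ℝ] E) (g : E) (ε : ℝ) (p : ℝ × E) : ℝ × E :=
  (phi T g p.2, p.2 + (ε * p.1) • gradPhi T g p.2)

end Defs

section Estimates

variable {E : Type*} [NormedAddCommGroup E] [InnerProductSpace ℝ E]
  {T : E →L[ℝ] E} {m : ℝ} (h : SymmCoercive T m)

include h

lemma SymmCoercive.nonneg (w : E) : 0 ≤ inner ℝ w (T w) :=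
  (mul_nonneg h.pos.le (sq_nonneg _)).trans (h.coercive w)

lemma sigma_sq (w : E) : sigma T w ^ 2 = inner ℝ w (T w) := Real.sq_sqrt (h.nonneg w)

lemma mul_norm_sq_le_sigma_sq (w : E) : m * ‖w‖ ^ 2 ≤ sigma T w ^ 2 :=
  (h.coercive w).trans_eq (sigma_sq h w).symm

lemma sigma_pos {w : E} (hw : w ≠ 0) : 0 < sigma T w := by
  refine Real.sqrt_pos.2 (lt_of_lt_of_le ?_ (h.coercive w))
  have := h.pos
  have := norm_pos_iff.2 hw
  positivity

lemma sigma_sq_le (w : E) : sigma T w ^ 2 ≤ ‖T‖ * ‖w‖ ^ 2 := by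
  rw [sigma_sq h]
  calc inner ℝ w (T w) ≤ ‖w‖ * ‖T w‖ := real_inner_le_norm _ _
    _ ≤ ‖w‖ * (‖T‖ * ‖w‖) := by gcongr; exact T.le_opNorm w
    _ = ‖T‖ * ‖w‖ ^ 2 := by ring

lemma inner_apply_comm (x y : E) : inner ℝ x (T y) = inner ℝ y (T x) := by
  rw [← h.symm, real_inner_comm]

lemma inner_sq_le (x y : E) : inner ℝ x (T y) ^ 2 ≤ sigma T x ^ 2 * sigma T y ^ 2 := by
  rcases eq_or_ne y 0 with rfl | hy
  · simpa using mul_nonneg (sq_nonneg (sigma T x)) (sq_nonneg (sigma T (0 : E)))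
  have hy' := sigma_pos h hy
  have key := h.nonneg (sigma T y ^ 2 • x - inner ℝ x (T y) • y)
  simp only [map_sub, map_smul, inner_sub_left, inner_sub_right, inner_smul_left,
    inner_smul_right, RCLike.conj_to_real] at key
  rw [inner_apply_comm h y x, ← sigma_sq h x, ← sigma_sq h y] at key
  have h2 : 0 ≤ sigma T y ^ 2 * (sigma T x ^ 2 * sigma T y ^ 2 - inner ℝ x (T y) ^ 2) := by
    nlinarith [key]
  nlinarith [nonneg_of_mul_nonneg_right h2 (by positivity)]

lemma abs_inner_le (x y : E) : |inner ℝ x (T y)| ≤ sigma T x * sigma T y := by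
  refine abs_le_of_sq_le_sq ?_ (mul_nonneg (Real.sqrt_nonneg _) (Real.sqrt_nonneg _))
  rw [mul_pow]; exact inner_sq_le h x y

lemma sigma_add_sq (x y : E) :
    sigma T (x + y) ^ 2 = sigma T x ^ 2 + 2 * inner ℝ x (T y) + sigma T y ^ 2 := by
  simp only [sigma_sq h, map_add, inner_add_left, inner_add_right]
  rw [inner_apply_comm h y x]; ring

lemma abs_sigma_add_sub_le (x y : E) : |sigma T (x + y) - sigma T x| ≤ sigma T y := by
  have h1 := sigma_add_sq h x y
  have h2 := abs_le.1 (abs_inner_le h x y)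
  have hx : 0 ≤ sigma T x := Real.sqrt_nonneg _
  have hy : 0 ≤ sigma T y := Real.sqrt_nonneg _
  have hz : 0 ≤ sigma T (x + y) := Real.sqrt_nonneg _
  rw [← sq_le_sq₀ (abs_nonneg _) hy, sq_abs]
  by_cases hc : sigma T (x + y) ^ 2 + sigma T x ^ 2 ≤ sigma T y ^ 2
  · nlinarith
  have h3 : (sigma T (x + y) ^ 2 + sigma T x ^ 2 - sigma T y ^ 2) ^ 2 ≤
      (2 * sigma T (x + y) * sigma T x) ^ 2 := by
    have := inner_sq_le h x y
    rw [mul_pow, mul_pow, h1]; nlinarith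
  have := abs_le_of_sq_le_sq' h3 (by positivity)
  nlinarith

lemma inner_gradPhi {w : E} (hw : w ≠ 0) (g : E) : inner ℝ w (gradPhi T g w) = 0 := by
  have := (sigma_pos h hw).ne'
  simp only [gradPhi, inner_smul_right, inner_sub_right, ← sigma_sq h]
  field_simp
  ring

lemma norm_add_smul_gradPhi_sq {w : E} (hw : w ≠ 0) (g : E) (t : ℝ) :
    ‖w + t • gradPhi T g w‖ ^ 2 = ‖w‖ ^ 2 + t ^ 2 * ‖gradPhi T g w‖ ^ 2 := by
  rw [norm_add_sq_real, inner_smul_right, inner_gradPhi h hw, norm_smul, mul_pow, Real.norm_eq_abs,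
    sq_abs]
  ring

omit h in
lemma gradPhi_eq (u w : E) : gradPhi T (T u) w =
    (sigma T w)⁻¹ • T (u - (phi T (T u) w / sigma T w) • w) := by
  rw [gradPhi, map_sub, map_smul, phi, div_div, ← sq]

lemma residual_energy {w : E} (hw : w ≠ 0) (u : E) :
    sigma T (u - (phi T (T u) w / sigma T w) • w) ^ 2 = sigma T u ^ 2 - phi T (T u) w ^ 2 := by
  have := (sigma_pos h hw).ne'
  simp only [phi, sigma_sq h (u - _), map_sub, map_smul, inner_sub_left, inner_sub_right,
    inner_smul_left, inner_smul_right, RCLike.conj_to_real, ← sigma_sq h]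
  rw [inner_apply_comm h u w]
  field_simp
  ring

lemma abs_phi_le {w : E} (hw : w ≠ 0) (u : E) : |phi T (T u) w| ≤ sigma T u := by
  have := residual_energy h hw u
  exact abs_le_of_sq_le_sq (by nlinarith [sq_nonneg (sigma T (u - (phi T (T u) w / sigma T w) • w))])
    (Real.sqrt_nonneg _)

lemma norm_gradPhi_sq_le {w : E} (hw : w ≠ 0) (u : E) :
    ‖gradPhi T (T u) w‖ ^ 2 ≤ ‖T‖ ^ 2 * sigma T u ^ 2 / m ^ 2 / ‖w‖ ^ 2 := by
  have hs := sigma_pos h hw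
  have hm := h.pos
  have hw' := norm_pos_iff.2 hw
  rw [gradPhi_eq]
  set r := u - (phi T (T u) w / sigma T w) • w with hr
  have h1 : m * ‖r‖ ^ 2 ≤ sigma T u ^ 2 := by
    have := mul_norm_sq_le_sigma_sq h r
    rw [hr, residual_energy h hw, ← hr] at this
    nlinarith [sq_nonneg (phi T (T u) w)]
  have h2 := mul_norm_sq_le_sigma_sq h w
  have h3 : ‖T r‖ ^ 2 ≤ ‖T‖ ^ 2 * ‖r‖ ^ 2 := by
    rw [← mul_pow]; gcongr; exact T.le_opNorm r
  rw [norm_smul, mul_pow, norm_inv, Real.norm_of_nonneg hs.le]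
  calc (sigma T w)⁻¹ ^ 2 * ‖T r‖ ^ 2 ≤ (m * ‖w‖ ^ 2)⁻¹ * (‖T‖ ^ 2 * (sigma T u ^ 2 / m)) := by
        rw [inv_pow]
        gcongr
        refine h3.trans ?_
        gcongr
        rw [le_div_iff₀ hm]; linarith
    _ = _ := by field_simp

lemma mul_le_sigma_sq_mul_norm_gradPhi_sq {w : E} (hw : w ≠ 0) (u : E) :
    m * (sigma T u ^ 2 - phi T (T u) w ^ 2) ≤ sigma T w ^ 2 * ‖gradPhi T (T u) w‖ ^ 2 := by
  have hs := sigma_pos h hw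
  have hm := h.pos
  rw [gradPhi_eq, ← residual_energy h hw]
  set r := u - (phi T (T u) w / sigma T w) • w with hr
  rw [norm_smul, mul_pow, norm_inv, Real.norm_of_nonneg hs.le, ← mul_assoc, ← mul_pow,
    mul_inv_cancel₀ hs.ne', one_pow, one_mul, sigma_sq h]
  have h1 := h.coercive r
  have h2 := real_inner_le_norm r (T r)
  rcases (norm_nonneg r).eq_or_lt with h0 | h0
  · rw [← h0] at h2
    nlinarith [sq_nonneg ‖T r‖]
  have h3 : m * ‖r‖ ≤ ‖T r‖ := by
    refine le_of_mul_le_mul_left ?_ h0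
    nlinarith
  nlinarith [norm_nonneg (T r)]

lemma eq_smul_of_gradPhi_eq_zero {w : E} (hw : w ≠ 0) {u : E} (hN : gradPhi T (T u) w = 0) :
    u = (phi T (T u) w / sigma T w) • w := by
  have h1 := mul_le_sigma_sq_mul_norm_gradPhi_sq h hw u
  rw [hN, norm_zero, ← residual_energy h hw] at h1
  have h2 := mul_norm_sq_le_sigma_sq h (u - (phi T (T u) w / sigma T w) • w)
  have hm := h.pos
  have h3 : m * (m * ‖u - (phi T (T u) w / sigma T w) • w‖ ^ 2) ≤ 0 := by nlinarith
  have h4 : ‖u - (phi T (T u) w / sigma T w) • w‖ ^ 2 = 0 := by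
    by_contra hne
    have : 0 < ‖u - (phi T (T u) w / sigma T w) • w‖ ^ 2 := lt_of_le_of_ne (sq_nonneg _) (Ne.symm hne)
    have : 0 < m * (m * ‖u - (phi T (T u) w / sigma T w) • w‖ ^ 2) := by positivity
    linarith
  rw [← sub_eq_zero, ← norm_eq_zero]
  exact pow_eq_zero_iff two_ne_zero |>.1 h4

lemma abs_phi_add_sub_le (u : E) : ∃ C, 0 < C ∧ ∀ w ≠ 0, ∀ t : ℝ,
    |phi T (T u) (w + t • gradPhi T (T u) w) - phi T (T u) w - t * ‖gradPhi T (T u) w‖ ^ 2| ≤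
      C * t ^ 2 * ‖gradPhi T (T u) w‖ ^ 2 / ‖w‖ ^ 2 := by
  have hm := h.pos
  set K := ‖T‖ ^ 2 * sigma T u ^ 2 / m ^ 2 with hK
  have hM : 0 ≤ sigma T u := Real.sqrt_nonneg _
  have hK0 : 0 ≤ K := by positivity
  refine ⟨(sigma T u * ‖T‖ / 2 + ‖T‖ * √K) / m + 1, by positivity, fun w hw t => ?_⟩
  have hw' := norm_pos_iff.2 hw
  have hs := sigma_pos h hw
  have hφ := abs_phi_le h hw u
  have hn := norm_gradPhi_sq_le h hw u
  rw [← hK] at hn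
  have hnorm := norm_add_smul_gradPhi_sq h hw (T u) t
  have hinner : inner ℝ (gradPhi T (T u) w) (T u) = sigma T w * ‖gradPhi T (T u) w‖ ^ 2 +
      phi T (T u) w / sigma T w * inner ℝ w (T (gradPhi T (T u) w)) := by
    have e : T u = sigma T w • gradPhi T (T u) w + (phi T (T u) w / sigma T w) • T w := by
      rw [gradPhi_eq, smul_smul, mul_inv_cancel₀ hs.ne', one_smul, map_sub, map_smul]; abel
    have e' := congrArg (fun z => inner ℝ (gradPhi T (T u) w) z) e
    simp only [inner_add_right, inner_smul_right, real_inner_self_eq_norm_sq] at e'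
    rwa [inner_apply_comm h _ w] at e'
  set N := gradPhi T (T u) w
  have hne : w + t • N ≠ 0 := by
    intro h0; rw [h0, norm_zero] at hnorm
    have : 0 < ‖w‖ ^ 2 + t ^ 2 * ‖N‖ ^ 2 := by positivity
    linarith
  have hs' := sigma_pos h hne
  have hadd := abs_sigma_add_sub_le h w (t • N)
  have haddsq := sigma_add_sq h w (t • N)
  have hsm : sigma T (t • N) = |t| * sigma T N := by
    rw [sigma, sigma, map_smul, inner_smul_left, inner_smul_right, RCLike.conj_to_real, ← mul_assoc,
      ← sq, Real.sqrt_mul (sq_nonneg t), Real.sqrt_sq_eq_abs]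
  have hb : phi T (T u) w * sigma T w = inner ℝ w (T u) := div_mul_cancel₀ _ hs.ne'
  have hb' : phi T (T u) (w + t • N) * sigma T (w + t • N) = inner ℝ w (T u) +
      t * inner ℝ N (T u) := by
    rw [phi, div_mul_cancel₀ _ hs'.ne', inner_add_left, inner_smul_left]; rfl
  rw [map_smul, inner_smul_right, hsm] at haddsq
  rw [hsm] at hadd
  have hprod : m * ‖w‖ ^ 2 ≤ sigma T w * sigma T (w + t • N) := by
    have h1 := mul_norm_sq_le_sigma_sq h w
    have h2 := mul_norm_sq_le_sigma_sq h (w + t • N)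
    have h3 : (m * ‖w‖ ^ 2) ^ 2 ≤ (sigma T w * sigma T (w + t • N)) ^ 2 := by
      rw [sq (m * ‖w‖ ^ 2), mul_pow]
      gcongr
      refine le_trans ?_ h2
      rw [hnorm]
      gcongr
      nlinarith [mul_nonneg (sq_nonneg t) (sq_nonneg ‖N‖)]
    exact (abs_le_of_sq_le_sq' h3 (by positivity)).2
  have hsN := sigma_sq_le h N
  have hsN0 : 0 ≤ sigma T N := Real.sqrt_nonneg _
  have hD : sigma T w * sigma T N ≤ ‖T‖ * √K := by
    refine (abs_le_of_sq_le_sq' ?_ (by positivity)).2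
    rw [mul_pow, mul_pow, Real.sq_sqrt hK0]
    calc sigma T w ^ 2 * sigma T N ^ 2 ≤ (‖T‖ * ‖w‖ ^ 2) * (‖T‖ * (K / ‖w‖ ^ 2)) := by
          gcongr
          · exact sigma_sq_le h w
          · exact hsN.trans (by gcongr)
      _ = ‖T‖ ^ 2 * K := by field_simp
  set q := inner ℝ w (T N)
  set s := sigma T w
  set s' := sigma T (w + t • N)
  set φ := phi T (T u) w
  set φ' := phi T (T u) (w + t • N)
  have habs := abs_le.1 hadd
  have hid : (φ' - φ - t * ‖N‖ ^ 2) * (s * s') =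
      φ * (((s - s') ^ 2 - (|t| * sigma T N) ^ 2) / 2) + t * ‖N‖ ^ 2 * s * (s - s') := by
    have hsinv : φ / s * s = φ := div_mul_cancel₀ _ hs.ne'
    rw [hinner, ← hb] at hb'
    linear_combination s * hb' + t * q * hsinv - φ / 2 * haddsq
  have hsq : |(s - s') ^ 2 - (|t| * sigma T N) ^ 2| ≤ t ^ 2 * (‖T‖ * ‖N‖ ^ 2) := by
    have h1 : (s - s') ^ 2 ≤ (|t| * sigma T N) ^ 2 := by
      rw [← sq_abs (s - s'), abs_sub_comm]; gcongr
    rw [abs_of_nonpos (by linarith), mul_pow, sq_abs]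
    nlinarith [sq_nonneg (s - s'), mul_le_mul_of_nonneg_left hsN (sq_nonneg t)]
  have hbound : |φ' - φ - t * ‖N‖ ^ 2| * (s * s') ≤
      (sigma T u * ‖T‖ / 2 + ‖T‖ * √K) * (t ^ 2 * ‖N‖ ^ 2) := by
    rw [← abs_of_pos (mul_pos hs hs'), ← abs_mul, hid]
    refine (abs_add_le _ _).trans ?_
    rw [add_mul]
    refine add_le_add ?_ ?_
    · rw [abs_mul, abs_div, abs_two]
      calc |φ| * (|(s - s') ^ 2 - (|t| * sigma T N) ^ 2| / 2)
          ≤ sigma T u * (t ^ 2 * (‖T‖ * ‖N‖ ^ 2) / 2) := by gcongr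
        _ = _ := by ring
    · rw [abs_mul, abs_mul, abs_mul, abs_of_pos hs, abs_of_nonneg (sq_nonneg ‖N‖),
        abs_sub_comm s s']
      calc |t| * ‖N‖ ^ 2 * s * |s' - s| ≤ |t| * ‖N‖ ^ 2 * s * (|t| * sigma T N) := by gcongr
        _ = (s * sigma T N) * (|t| ^ 2 * ‖N‖ ^ 2) := by ring
        _ ≤ (‖T‖ * √K) * (t ^ 2 * ‖N‖ ^ 2) := by rw [sq_abs]; gcongr
  have h5 : |φ' - φ - t * ‖N‖ ^ 2| * (m * ‖w‖ ^ 2) ≤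
      (sigma T u * ‖T‖ / 2 + ‖T‖ * √K) * (t ^ 2 * ‖N‖ ^ 2) :=
    (mul_le_mul_of_nonneg_left hprod (abs_nonneg _)).trans hbound
  rw [← le_div_iff₀ (by positivity)] at h5
  refine h5.trans ?_
  have h6 : 0 ≤ t ^ 2 * ‖N‖ ^ 2 / ‖w‖ ^ 2 := by positivity
  calc (sigma T u * ‖T‖ / 2 + ‖T‖ * √K) * (t ^ 2 * ‖N‖ ^ 2) / (m * ‖w‖ ^ 2)
      = (sigma T u * ‖T‖ / 2 + ‖T‖ * √K) / m * (t ^ 2 * ‖N‖ ^ 2 / ‖w‖ ^ 2) := by field_simp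
    _ ≤ ((sigma T u * ‖T‖ / 2 + ‖T‖ * √K) / m + 1) * (t ^ 2 * ‖N‖ ^ 2 / ‖w‖ ^ 2) := by
        gcongr; linarith
    _ = _ := by ring

end Estimates

section Scalar

lemma exists_tendsto_of_cubic_tendsto_zero {x : ℕ → ℝ} {M : ℝ} (hM : 0 < M)
    (hx : ∀ k, |x k| ≤ M) (hd : Tendsto (fun k => x (k + 1) - x k) atTop (𝓝 0))
    (hc : Tendsto (fun k => x k * (M ^ 2 - x k ^ 2)) atTop (𝓝 0)) :
    ∃ c, (c = 0 ∨ c = M ∨ c = -M) ∧ Tendsto x atTop (𝓝 c) := by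
  have near : ∀ c, (c = 0 ∨ c = M ∨ c = -M) → ∀ y, |y - c| ≤ M / 2 →
      3 / 4 * M ^ 2 * |y - c| ≤ |y * (M ^ 2 - y ^ 2)| := by
    rintro c (rfl | rfl | rfl) y hy
    · rw [sub_zero] at hy ⊢
      rw [abs_mul, mul_comm]
      gcongr
      rw [← sq_abs y]
      refine le_trans ?_ (le_abs_self _)
      nlinarith [abs_nonneg y]
    · rw [show y * (c ^ 2 - y ^ 2) = -((y * (c + y)) * (y - c)) by ring, abs_neg, abs_mul]
      have := abs_le.1 hy
      gcongr
      refine le_trans ?_ (le_abs_self _)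
      nlinarith
    · rw [show y * (M ^ 2 - y ^ 2) = -(((-y) * (M - y)) * (y - -M)) by ring, abs_neg, abs_mul]
      have := abs_le.1 hy
      gcongr
      refine le_trans ?_ (le_abs_self _)
      nlinarith
  have choice : ∀ y, |y| ≤ M → ∃ c, (c = 0 ∨ c = M ∨ c = -M) ∧ |y - c| ≤ M / 2 := by
    intro y hy
    have := abs_le.1 hy
    rcases le_total y (-(M / 2)) with h1 | h1
    · exact ⟨-M, by simp, abs_le.2 ⟨by linarith, by linarith⟩⟩
    rcases le_total y (M / 2) with h2 | h2
    · exact ⟨0, by simp, abs_le.2 ⟨by linarith, by linarith⟩⟩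
    · exact ⟨M, by simp, abs_le.2 ⟨by linarith, by linarith⟩⟩
  have h1 : ∀ᶠ k in atTop, |x (k + 1) - x k| < M / 4 :=
    (by simpa using hd.abs : Tendsto (fun k => |x (k + 1) - x k|) atTop (𝓝 0)).eventually_lt_const
      (by positivity)
  have h2 : ∀ᶠ k in atTop, |x k * (M ^ 2 - x k ^ 2)| < 3 / 4 * M ^ 2 * (M / 4) :=
    (by simpa using hc.abs : Tendsto (fun k => |x k * (M ^ 2 - x k ^ 2)|) atTop
      (𝓝 0)).eventually_lt_const (by positivity)
  obtain ⟨k₀, hk⟩ := eventually_atTop.1 (h1.and h2)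
  obtain ⟨c, hcc, hc0⟩ := choice (x k₀) (hx k₀)
  have stay : ∀ k ≥ k₀, |x k - c| ≤ M / 2 := by
    intro k hk0
    induction k, hk0 using Nat.le_induction with
    | base => exact hc0
    | succ k hk0 ih =>
      have e1 := near c hcc _ ih
      have e2 := (hk k hk0).2
      have e3 : |x k - c| < M / 4 := by
        by_contra! hcon
        have : 3 / 4 * M ^ 2 * (M / 4) ≤ 3 / 4 * M ^ 2 * |x k - c| := by gcongr
        linarith
      calc |x (k + 1) - c| ≤ |x (k + 1) - x k| + |x k - c| := abs_sub_le _ _ _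
        _ ≤ M / 2 := by linarith [(hk k hk0).1]
  refine ⟨c, hcc, ?_⟩
  rw [tendsto_iff_dist_tendsto_zero]
  have hlim : Tendsto (fun k => |x k * (M ^ 2 - x k ^ 2)| / (3 / 4 * M ^ 2)) atTop (𝓝 0) := by
    simpa using hc.abs.div_const (3 / 4 * M ^ 2)
  refine squeeze_zero' (Eventually.of_forall fun _ => dist_nonneg) ?_ hlim
  filter_upwards [eventually_ge_atTop k₀] with k hk0
  rw [le_div_iff₀ (by positivity), Real.dist_eq, mul_comm]
  exact near c hcc _ (stay k hk0)

/-- The scalar relations satisfied along a BNGD orbit by `a`, `r = ‖w‖²` and `n = ‖∇φ(w)‖²`. -/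
structure ScalarOrbit (ε A C K M c : ℝ) (a r n : ℕ → ℝ) : Prop where
  eps_pos : 0 < ε
  C_pos : 0 < C
  K_nonneg : 0 ≤ K
  M_pos : 0 < M
  c_pos : 0 < c
  r_pos : 0 < r 0
  n_nonneg : ∀ k, 0 ≤ n k
  n_le : ∀ k, n k ≤ K / r k
  abs_le : ∀ k, |a k| ≤ A
  abs_succ_le : ∀ k, |a (k + 1)| ≤ M
  r_succ : ∀ k, r (k + 1) = r k + (ε * a k) ^ 2 * n k
  taylor : ∀ k, |a (k + 2) - a (k + 1) - ε * a k * n k| ≤ C * (ε * a k) ^ 2 * n k / r k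
  lower : ∀ k, c * (M ^ 2 - a (k + 1) ^ 2) ≤ r k * n k

namespace ScalarOrbit

variable {ε A C K M c : ℝ} {a r n : ℕ → ℝ} (o : ScalarOrbit ε A C K M c a r n)

include o

lemma monotone : Monotone r := by
  refine monotone_nat_of_le_succ fun k => ?_
  rw [o.r_succ]
  have := o.n_nonneg k
  nlinarith [mul_nonneg (sq_nonneg (ε * a k)) this]

lemma pos (k : ℕ) : 0 < r k := o.r_pos.trans_le (o.monotone (Nat.zero_le k))

lemma A_nonneg : 0 ≤ A := (abs_nonneg _).trans (o.abs_le 0)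

lemma abs_sub_le_half {k : ℕ} (hk : 2 * (C * ε * A) ≤ r k) :
    |a (k + 2) - a (k + 1) - ε * a k * n k| ≤ |ε * a k * n k| / 2 := by
  have hr := o.pos k
  have hn := o.n_nonneg k
  have hε := o.eps_pos
  have hC := o.C_pos
  refine (o.taylor k).trans ?_
  rw [abs_mul, abs_mul, abs_of_pos hε, abs_of_nonneg hn, div_le_iff₀ hr, mul_pow, ← sq_abs (a k)]
  have h1 : C * ε * |a k| ≤ r k / 2 := by
    have : C * ε * |a k| ≤ C * ε * A := by gcongr; exact o.abs_le k
    linarith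
  have h2 : 0 ≤ ε * |a k| * n k := by positivity
  nlinarith [mul_le_mul_of_nonneg_left h1 h2]

lemma bounded_of_large {k₀ : ℕ} (h1 : 2 * (C * ε * A) ≤ r k₀) (h2 : 4 * (ε * K) ≤ r k₀) :
    ∃ B, ∀ k ≥ k₀, r k ≤ B := by
  have hε := o.eps_pos
  have hA := o.A_nonneg
  have half : ∀ k ≥ k₀, |a (k + 2) - a (k + 1) - ε * a k * n k| ≤ |ε * a k * n k| / 2 :=
    fun k hk => o.abs_sub_le_half (h1.trans (o.monotone hk))
  by_cases hs : ∃ k ≥ k₀, 0 < a k * a (k + 1)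
  · obtain ⟨k₁, hk₁, hpos⟩ := hs
    have step : ∀ k ≥ k₀, 0 < a k * a (k + 1) →
        0 < a (k + 1) * a (k + 2) ∧ |a (k + 1)| + ε * |a k| * n k / 2 ≤ |a (k + 2)| := by
      intro k hk hp
      have hh := half k hk
      have hn := o.n_nonneg k
      rcases pos_and_pos_or_neg_and_neg_of_mul_pos hp with ⟨p1, p2⟩ | ⟨p1, p2⟩
      · have ht : 0 ≤ ε * a k * n k := by positivity
        rw [abs_of_nonneg ht] at hh
        have := _root_.abs_le.1 hh
        have p3 : 0 < a (k + 2) := by linarith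
        rw [abs_of_pos p1, abs_of_pos p2, abs_of_pos p3]
        exact ⟨by positivity, by linarith⟩
      · have ht : ε * a k * n k ≤ 0 := by
          have : 0 ≤ ε * (-a k) * n k := by
            have : 0 < -a k := by linarith
            positivity
          linarith
        rw [abs_of_nonpos ht] at hh
        have := _root_.abs_le.1 hh
        have p3 : a (k + 2) < 0 := by linarith
        rw [abs_of_neg p1, abs_of_neg p2, abs_of_neg p3]
        exact ⟨mul_pos_of_neg_of_neg p2 p3, by linarith⟩
    have hsign : ∀ k ≥ k₁, 0 < a k * a (k + 1) := by
      intro k hk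
      induction k, hk using Nat.le_induction with
      | base => exact hpos
      | succ k hk ih => exact (step k (hk₁.trans hk) ih).1
    have hpot : ∀ k ≥ k₁, r k - 2 * ε * A * |a (k + 1)| ≤ r k₁ - 2 * ε * A * |a (k₁ + 1)| := by
      intro k hk
      induction k, hk using Nat.le_induction with
      | base => exact le_rfl
      | succ k hk ih =>
        have h3 := (step k (hk₁.trans hk) (hsign k hk)).2
        have hn := o.n_nonneg k
        refine le_trans ?_ ih
        rw [o.r_succ, mul_pow, ← sq_abs (a k)]
        have h4 : |a k| ^ 2 * n k ≤ A * (|a k| * n k) := by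
          rw [sq, mul_assoc]; gcongr; exact o.abs_le k
        have h5 : 0 ≤ 2 * ε * A := by positivity
        nlinarith [mul_le_mul_of_nonneg_left h3 h5, mul_le_mul_of_nonneg_left h4 (sq_nonneg ε)]
    refine ⟨r k₁ + 2 * ε * A * A, fun k hk => ?_⟩
    have h6 := hpot (max k k₁) (le_max_right _ _)
    have h7 := o.monotone (le_max_left k k₁)
    have h8 : 2 * ε * A * |a (max k k₁ + 1)| ≤ 2 * ε * A * A := by
      gcongr; exact o.abs_le _
    have h9 : 0 ≤ 2 * ε * A * |a (k₁ + 1)| := by positivity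
    linarith
  · push Not at hs
    have hsmall : ∀ k ≥ k₀, ε * n k ≤ 1 / 4 := by
      intro k hk
      have hr := o.pos k
      calc ε * n k ≤ ε * (K / r k) := by gcongr; exact o.n_le k
        _ ≤ 1 / 4 := by
          rw [← mul_div_assoc, div_le_div_iff₀ hr (by norm_num)]
          linarith [h2.trans (o.monotone hk)]
    have hdecay : ∀ k ≥ k₀, |a (k + 2)| ≤ |a k| / 2 := by
      intro k hk
      have hh := half k hk
      have s1 := hs k hk
      have s2 := hs (k + 1) (by omega)
      have hn := o.n_nonneg k
      have e1 : |ε * a k * n k| ≤ |a k| / 4 := by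
        rw [show ε * a k * n k = (ε * n k) * a k by ring, abs_mul, abs_of_nonneg (by positivity)]
        nlinarith [hsmall k hk, abs_nonneg (a k)]
      have e2 := _root_.abs_le.1 hh
      have h3 : |a (k + 2)| ≤ 3 / 2 * |ε * a k * n k| := by
        have t1 := le_abs_self (ε * a k * n k)
        have t2 := neg_abs_le (ε * a k * n k)
        rcases lt_trichotomy (a (k + 1)) 0 with p | p | p
        · have s3 : 0 ≤ a (k + 2) := nonneg_of_mul_nonpos_right s2 p
          rw [abs_of_nonneg s3]; linarith
        · exact _root_.abs_le.2 ⟨by linarith, by linarith⟩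
        · have s3 : a (k + 2) ≤ 0 := nonpos_of_mul_nonpos_right s2 p
          rw [abs_of_nonpos s3]; linarith
      linarith [abs_nonneg (a k)]
    have hpot : ∀ k ≥ k₀, r k + ε * (a k ^ 2 + a (k + 1) ^ 2) ≤
        r k₀ + ε * (a k₀ ^ 2 + a (k₀ + 1) ^ 2) := by
      intro k hk
      induction k, hk using Nat.le_induction with
      | base => exact le_rfl
      | succ k hk ih =>
        refine le_trans ?_ ih
        have h3 := hdecay k hk
        have h4 : a (k + 2) ^ 2 ≤ a k ^ 2 / 4 := by
          rw [← sq_abs, ← sq_abs (a k)]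
          nlinarith [abs_nonneg (a (k + 2)), abs_nonneg (a k)]
        have h5 : (ε * a k) ^ 2 * n k ≤ ε * (a k ^ 2 / 4) := by
          have := mul_le_mul_of_nonneg_left (hsmall k hk) (mul_nonneg hε.le (sq_nonneg (a k)))
          nlinarith
        rw [o.r_succ]
        nlinarith [mul_le_mul_of_nonneg_left h4 hε.le, mul_nonneg hε.le (sq_nonneg (a k))]
    refine ⟨r k₀ + ε * (a k₀ ^ 2 + a (k₀ + 1) ^ 2), fun k hk => ?_⟩
    have : 0 ≤ ε * (a k ^ 2 + a (k + 1) ^ 2) := by positivity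
    linarith [hpot k hk]

lemma exists_tendsto_r : ∃ l, 0 < l ∧ Tendsto r atTop (𝓝 l) := by
  rcases tendsto_atTop_of_monotone o.monotone with ht | ⟨l, hl⟩
  · exfalso
    obtain ⟨k₀, hk₀⟩ := ((ht.eventually_ge_atTop (2 * (C * ε * A))).and
      (ht.eventually_ge_atTop (4 * (ε * K)))).exists
    obtain ⟨B, hB⟩ := o.bounded_of_large hk₀.1 hk₀.2
    obtain ⟨k, hk1, hk2⟩ := ((ht.eventually_gt_atTop B).and (eventually_ge_atTop k₀)).exists
    exact absurd (hB k hk2) (not_le.2 hk1)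
  · exact ⟨l, o.r_pos.trans_le (o.monotone.ge_of_tendsto hl 0), hl⟩

lemma tendsto_step : Tendsto (fun k => (ε * a k) ^ 2 * n k) atTop (𝓝 0) := by
  obtain ⟨l, -, hl⟩ := o.exists_tendsto_r
  have h1 := (hl.comp (tendsto_add_atTop_nat 1)).sub hl
  rw [sub_self] at h1
  refine h1.congr fun k => ?_
  simp [o.r_succ]

lemma n_le_const (k : ℕ) : n k ≤ K / r 0 :=
  (o.n_le k).trans (div_le_div_of_nonneg_left o.K_nonneg o.r_pos (o.monotone (Nat.zero_le k)))

lemma tendsto_mul_n : Tendsto (fun k => ε * a k * n k) atTop (𝓝 0) := by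
  have h1 : Tendsto (fun k => (ε * a k * n k) ^ 2) atTop (𝓝 0) := by
    have h2 := o.tendsto_step.mul_const (K / r 0)
    rw [zero_mul] at h2
    refine squeeze_zero (fun _ => sq_nonneg _) (fun k => ?_) h2
    have := o.n_nonneg k
    calc (ε * a k * n k) ^ 2 = ((ε * a k) ^ 2 * n k) * n k := by ring
      _ ≤ _ := by gcongr; exact o.n_le_const k
  have h3 := h1.sqrt
  simp only [Real.sqrt_sq_eq_abs, Real.sqrt_zero] at h3
  exact (tendsto_zero_iff_abs_tendsto_zero _).2 h3

lemma tendsto_diff : Tendsto (fun k => a (k + 2) - a (k + 1)) atTop (𝓝 0) := by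
  have h1 : Tendsto (fun k => a (k + 2) - a (k + 1) - ε * a k * n k) atTop (𝓝 0) := by
    have h2 := o.tendsto_step.const_mul (C / r 0)
    rw [mul_zero] at h2
    refine squeeze_zero_norm (fun k => (o.taylor k).trans ?_) h2
    have := o.n_nonneg k
    have := o.C_pos
    calc C * (ε * a k) ^ 2 * n k / r k ≤ C * (ε * a k) ^ 2 * n k / r 0 := by
          gcongr
          · exact o.r_pos
          · exact o.monotone (Nat.zero_le k)
      _ = _ := by ring
  simpa using h1.add o.tendsto_mul_n

lemma exists_tendsto_a : ∃ l, (l = 0 ∨ l = M ∨ l = -M) ∧ Tendsto a atTop (𝓝 l) := by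
  obtain ⟨ρ, -, hρ⟩ := o.exists_tendsto_r
  have hε := o.eps_pos
  have hc := o.c_pos
  have hn : Tendsto (fun k => a k * n k) atTop (𝓝 0) := by
    have := o.tendsto_mul_n.const_mul ε⁻¹
    rw [mul_zero] at this
    refine this.congr fun k => ?_
    field_simp
  have hn1 : Tendsto (fun k => a (k + 2) * n (k + 1)) atTop (𝓝 0) := by
    have h2 : Tendsto (fun k => (a (k + 2) - a (k + 1)) * n (k + 1)) atTop (𝓝 0) := by
      have h3 := o.tendsto_diff.abs.mul_const (K / r 0)
      rw [abs_zero, zero_mul] at h3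
      refine squeeze_zero_norm (fun k => ?_) h3
      rw [norm_mul, Real.norm_eq_abs, Real.norm_of_nonneg (o.n_nonneg _)]
      gcongr
      exact o.n_le_const _
    have h4 := h2.add (hn.comp (tendsto_add_atTop_nat 1))
    rw [zero_add] at h4
    refine h4.congr fun k => ?_
    simp only [Function.comp]
    ring
  have hcub : Tendsto (fun k => a (k + 2) * (M ^ 2 - a (k + 2) ^ 2)) atTop (𝓝 0) := by
    have h2 := (hn1.abs.mul (hρ.comp (tendsto_add_atTop_nat 1))).div_const c
    rw [abs_zero, zero_mul, zero_div] at h2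
    refine squeeze_zero_norm (fun k => ?_) h2
    have h3 := o.lower (k + 1)
    have h4 : 0 ≤ M ^ 2 - a (k + 2) ^ 2 := by
      have := sq_le_sq₀ (abs_nonneg _) o.M_pos.le |>.2 (o.abs_succ_le (k + 1))
      rw [sq_abs] at this
      linarith
    rw [norm_mul, Real.norm_eq_abs, Real.norm_of_nonneg h4, le_div_iff₀ hc]
    simp only [Function.comp]
    rw [abs_mul, abs_of_nonneg (o.n_nonneg _)]
    calc |a (k + 2)| * (M ^ 2 - a (k + 2) ^ 2) * c = |a (k + 2)| * (c * (M ^ 2 - a (k + 2) ^ 2)) := by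
          ring
      _ ≤ |a (k + 2)| * (r (k + 1) * n (k + 1)) := by gcongr
      _ = _ := by ring
  obtain ⟨l, hl, hl'⟩ := exists_tendsto_of_cubic_tendsto_zero (x := fun k => a (k + 2)) o.M_pos
    (fun k => o.abs_succ_le _) (o.tendsto_diff.comp (tendsto_add_atTop_nat 1)) hcub
  exact ⟨l, hl, (tendsto_add_atTop_iff_nat 2).1 hl'⟩

lemma summable_sq (h0 : Tendsto a atTop (𝓝 0)) : Summable fun k => a k ^ 2 := by
  obtain ⟨ρ, hρ0, hρ⟩ := o.exists_tendsto_r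
  have hrρ : ∀ k, r k ≤ ρ := o.monotone.ge_of_tendsto hρ
  have hε := o.eps_pos
  have hc := o.c_pos
  have hM := o.M_pos
  have hsum : Summable fun k => (ε * a k) ^ 2 * n k := by
    refine summable_of_sum_range_le (c := ρ) (fun k => mul_nonneg (sq_nonneg _) (o.n_nonneg k))
      fun k => ?_
    have : ∑ i ∈ Finset.range k, (ε * a i) ^ 2 * n i = r k - r 0 := by
      rw [← Finset.sum_range_sub]
      exact Finset.sum_congr rfl fun i _ => by rw [o.r_succ]; ring
    rw [this]
    linarith [hrρ k, o.r_pos]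
  have hev : ∀ᶠ k in atTop, a (k + 1) ^ 2 ≤ M ^ 2 / 2 := by
    have h1 := (h0.comp (tendsto_add_atTop_nat 1)).pow 2
    rw [zero_pow two_ne_zero] at h1
    exact h1.eventually_le_const (by positivity)
  refine Summable.of_norm_bounded_eventually_nat (g := fun k =>
    (2 * ρ / (ε ^ 2 * c * M ^ 2)) * ((ε * a k) ^ 2 * n k)) (hsum.mul_left _) ?_
  filter_upwards [hev] with k hk
  have h1 := o.lower k
  have h2 : c * (M ^ 2 / 2) ≤ ρ * n k := by
    have := mul_le_mul_of_nonneg_right (hrρ k) (o.n_nonneg k)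
    nlinarith
  rw [Real.norm_of_nonneg (sq_nonneg _), div_mul_eq_mul_div, le_div_iff₀ (by positivity)]
  nlinarith [mul_le_mul_of_nonneg_left h2 (mul_nonneg (sq_nonneg ε) (sq_nonneg (a k)))]

end ScalarOrbit

end Scalar

section Orbit

variable {E : Type*} [NormedAddCommGroup E] [InnerProductSpace ℝ E]
  {T : E →L[ℝ] E} {m : ℝ}

lemma continuous_sigma (T : E →L[ℝ] E) : Continuous (sigma T) := by
  unfold sigma; fun_prop

lemma continuousAt_phi (h : SymmCoercive T m) (g : E) {w : E} (hw : w ≠ 0) :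
    ContinuousAt (phi T g) w := by
  unfold phi
  exact ContinuousAt.div (by fun_prop) (continuous_sigma T).continuousAt (sigma_pos h hw).ne'

variable (h : SymmCoercive T m) {u : E} (hu : u ≠ 0) {ε : ℝ} (hε : 0 < ε)
  {a : ℕ → ℝ} {w : ℕ → E} (hw0 : w 0 ≠ 0) (ha : ∀ k, a (k + 1) = phi T (T u) (w k))
  (hw : ∀ k, w (k + 1) = w k + (ε * a k) • gradPhi T (T u) (w k))

include h hw0 hw

lemma orbit_ne_zero (k : ℕ) : w k ≠ 0 := by
  induction k with
  | zero => exact hw0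
  | succ k ih =>
    intro h0
    have h1 := norm_add_smul_gradPhi_sq h ih (T u) (ε * a k)
    rw [← hw, h0, norm_zero] at h1
    have := norm_pos_iff.2 ih
    have : 0 < ‖w k‖ ^ 2 + (ε * a k) ^ 2 * ‖gradPhi T (T u) (w k)‖ ^ 2 := by positivity
    linarith

include hu hε ha

lemma exists_scalarOrbit : ∃ A C K c, ScalarOrbit ε A C K (sigma T u) c a
    (fun k => ‖w k‖ ^ 2) (fun k => ‖gradPhi T (T u) (w k)‖ ^ 2) := by
  have hne := orbit_ne_zero h hw0 hw
  obtain ⟨C, hC, hT⟩ := abs_phi_add_sub_le h u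
  have hm := h.pos
  have hM := sigma_pos h hu
  have hφ : ∀ k, |a (k + 1)| ≤ sigma T u := fun k => by rw [ha]; exact abs_phi_le h (hne k) u
  refine ⟨max |a 0| (sigma T u), C, ‖T‖ ^ 2 * sigma T u ^ 2 / m ^ 2, m / (‖T‖ + 1), hε, hC,
    by positivity, hM, by positivity, by have := norm_pos_iff.2 hw0; positivity,
    fun k => sq_nonneg _, fun k => norm_gradPhi_sq_le h (hne k) u, ?_, hφ, ?_, ?_, ?_⟩
  · rintro (_ | k)
    · exact le_max_left _ _
    · exact (hφ k).trans (le_max_right _ _)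
  · intro k
    rw [hw, norm_add_smul_gradPhi_sq h (hne k)]
  · intro k
    have := hT (w k) (hne k) (ε * a k)
    rwa [← hw, ← ha, ← ha] at this
  · intro k
    rw [ha, div_mul_eq_mul_div, div_le_iff₀ (by positivity)]
    have h1 := mul_le_sigma_sq_mul_norm_gradPhi_sq h (hne k) u
    have h2 := mul_le_mul_of_nonneg_right (sigma_sq_le h (w k))
      (sq_nonneg ‖gradPhi T (T u) (w k)‖)
    nlinarith [mul_nonneg (sq_nonneg ‖w k‖) (sq_nonneg ‖gradPhi T (T u) (w k)‖)]

lemma tendsto_of_tendsto_extremal {s : ℝ} (hs : s = 1 ∨ s = -1)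
    (hlim : Tendsto a atTop (𝓝 (s * sigma T u))) :
    ∃ c : ℝ, c ≠ 0 ∧ Tendsto w atTop (𝓝 (c • u)) := by
  have hne := orbit_ne_zero h hw0 hw
  obtain ⟨A, C, K, c, o⟩ := exists_scalarOrbit h hu hε hw0 ha hw
  obtain ⟨l, hl, hl'⟩ := o.exists_tendsto_r
  have hnw : Tendsto (fun k => ‖w k‖) atTop (𝓝 √l) := by
    simpa only [Real.sqrt_sq (norm_nonneg _)] using hl'.sqrt
  have hl0 := Real.sqrt_pos.2 hl
  have hm := h.pos
  have hss : s ^ 2 = 1 := by rcases hs with rfl | rfl <;> norm_num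
  have ha1 := hlim.comp (tendsto_add_atTop_nat 1)
  have hres : Tendsto (fun k => u - (a (k + 1) / sigma T (w k)) • w k) atTop (𝓝 0) := by
    have h1 : Tendsto (fun k => (sigma T u ^ 2 - a (k + 1) ^ 2) / m) atTop (𝓝 0) := by
      have := ((ha1.pow 2).const_sub (sigma T u ^ 2)).div_const m
      rwa [mul_pow, hss, one_mul, sub_self, zero_div] at this
    have h2 : Tendsto (fun k => ‖u - (a (k + 1) / sigma T (w k)) • w k‖ ^ 2) atTop (𝓝 0) := by
      refine squeeze_zero (fun _ => sq_nonneg _) (fun k => ?_) h1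
      rw [le_div_iff₀ hm, ha, ← residual_energy h (hne k), mul_comm]
      exact mul_norm_sq_le_sigma_sq h _
    rw [tendsto_zero_iff_norm_tendsto_zero]
    simpa only [Real.sqrt_sq (norm_nonneg _), Real.sqrt_zero] using h2.sqrt
  have hu1 : Tendsto (fun k => (a (k + 1) / sigma T (w k)) • w k) atTop (𝓝 u) := by
    simpa using hres.const_sub u
  have hcoef : Tendsto (fun k => a (k + 1) / sigma T (w k)) atTop (𝓝 (s * (‖u‖ / √l))) := by
    have h1 := (hu1.norm.div hnw hl0.ne').const_mul s
    have h2 : ∀ᶠ k in atTop, 0 < s * a (k + 1) := by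
      have h3 := ha1.const_mul s
      rw [← mul_assoc, ← sq, hss, one_mul] at h3
      exact h3.eventually_const_lt (sigma_pos h hu)
    refine h1.congr' ?_
    filter_upwards [h2] with k hk
    have hsw := sigma_pos h (hne k)
    have hnk := norm_pos_iff.2 (hne k)
    have habs : |a (k + 1)| = s * a (k + 1) := by
      rcases hs with rfl | rfl
      · rw [one_mul] at hk ⊢; exact abs_of_pos hk
      · rw [neg_one_mul] at hk ⊢; exact abs_of_neg (by linarith)
    simp only [Pi.div_apply]
    rw [norm_smul, mul_div_cancel_right₀ _ hnk.ne', norm_div, Real.norm_of_nonneg hsw.le,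
      Real.norm_eq_abs, habs, ← mul_div_assoc, ← mul_assoc, ← sq, hss, one_mul]
  have hs0 : s ≠ 0 := by rintro rfl; norm_num at hss
  have hc0 : s * (‖u‖ / √l) ≠ 0 := by
    have := norm_pos_iff.2 hu
    positivity
  refine ⟨(s * (‖u‖ / √l))⁻¹, inv_ne_zero hc0, ?_⟩
  refine ((hcoef.inv₀ hc0).smul hu1).congr' ?_
  filter_upwards [hcoef.eventually_ne hc0] with k hk
  rw [smul_smul, inv_mul_cancel₀ hk, one_smul]

lemma tendsto_saddle_of_tendsto_zero [CompleteSpace E] (hlim : Tendsto a atTop (𝓝 0)) :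
    ∃ z ≠ 0, inner ℝ z (T u) = 0 ∧ Tendsto w atTop (𝓝 z) := by
  have hne := orbit_ne_zero h hw0 hw
  obtain ⟨A, C, K, c, o⟩ := exists_scalarOrbit h hu hε hw0 ha hw
  obtain ⟨l, hl, hl'⟩ := o.exists_tendsto_r
  have hnw : Tendsto (fun k => ‖w k‖) atTop (𝓝 √l) := by
    simpa only [Real.sqrt_sq (norm_nonneg _)] using hl'.sqrt
  have hl0 := Real.sqrt_pos.2 hl
  have hm := h.pos
  have hle : ∀ k, ‖w k‖ ^ 2 ≤ l := o.monotone.ge_of_tendsto hl'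
  have hle' : ∀ k, ‖w k‖ ≤ √l := fun k => Real.le_sqrt_of_sq_le (hle k)
  have hge : ∀ k, m * ‖w 0‖ ^ 2 ≤ sigma T (w k) ^ 2 := fun k =>
    (mul_le_mul_of_nonneg_left (o.monotone (Nat.zero_le k)) hm.le).trans
      (mul_norm_sq_le_sigma_sq h (w k))
  have hw0' := norm_pos_iff.2 hw0
  set g := T u with hg
  have hg0 : g ≠ 0 := by
    intro h0
    have := sigma_pos h hu
    rw [sigma, ← hg, h0, inner_zero_right, Real.sqrt_zero] at this
    exact lt_irrefl _ this
  have hgn := norm_pos_iff.2 hg0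
  set v : ℕ → E := fun k => w k - (inner ℝ (w k) g / ‖g‖ ^ 2) • g with hv
  set P : E → E := fun x => x - (inner ℝ x g / ‖g‖ ^ 2) • g with hP
  have hPadd : ∀ x y (t : ℝ), P (x + t • y) = P x + t • P y := by
    intro x y t
    simp only [hP, inner_add_left, inner_smul_left, RCLike.conj_to_real]
    module
  have hPg : P g = 0 := by
    simp only [hP, real_inner_self_eq_norm_sq]
    rw [div_self (by positivity), one_smul, sub_self]
  have hPn : ∀ x, ‖P x‖ ≤ 2 * ‖x‖ := by
    intro x
    have h1 : ‖(inner ℝ x g / ‖g‖ ^ 2) • g‖ ≤ ‖x‖ := by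
      rw [norm_smul, norm_div, norm_pow, norm_norm, div_mul_eq_mul_div, div_le_iff₀ (by positivity)]
      have := norm_inner_le_norm (𝕜 := ℝ) x g
      nlinarith
    linarith [norm_sub_le x ((inner ℝ x g / ‖g‖ ^ 2) • g)]
  set D := ε * (2 * (‖T‖ * √l)) / (m * ‖w 0‖ ^ 2) with hD
  have hD0 : 0 ≤ D := by positivity
  have hstep : ∀ k, dist (v k) (v (k + 1)) ≤ D * (a k ^ 2 + a (k + 1) ^ 2) := by
    intro k
    have hs := sigma_pos h (hne k)
    have e0 : gradPhi T g (w k) = (-(a (k + 1) / sigma T (w k) ^ 2)) • T (w k)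
        + (sigma T (w k))⁻¹ • g := by
      rw [ha, gradPhi, phi]
      match_scalars
      · field_simp
      · field_simp
    have e1 : v (k + 1) = v k + (ε * a k) • P (gradPhi T g (w k)) := by
      change P (w (k + 1)) = _
      rw [hw, hPadd]
    have e2 : P (gradPhi T g (w k)) = (-(a (k + 1) / sigma T (w k) ^ 2)) • P (T (w k)) := by
      rw [e0, hPadd, hPg, smul_zero, add_zero]
      have := hPadd 0 (T (w k)) (-(a (k + 1) / sigma T (w k) ^ 2))
      rw [zero_add] at this
      rw [this]
      simp [hP]
    have e3 : ‖P (T (w k))‖ ≤ 2 * (‖T‖ * √l) := by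
      refine (hPn _).trans ?_
      gcongr
      exact (T.le_opNorm _).trans (by gcongr; exact hle' k)
    rw [e1, dist_self_add_right, e2, smul_smul, norm_smul, norm_mul, norm_mul, norm_neg, norm_div,
      norm_pow, Real.norm_of_nonneg hε.le, Real.norm_of_nonneg hs.le, Real.norm_eq_abs,
      Real.norm_eq_abs]
    have e4 : |a k| * |a (k + 1)| ≤ a k ^ 2 + a (k + 1) ^ 2 := by
      rw [← sq_abs (a k), ← sq_abs (a (k + 1))]
      nlinarith [sq_nonneg (|a k| - |a (k + 1)|), sq_nonneg (|a k|), sq_nonneg (|a (k + 1)|)]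
    calc ε * |a k| * (|a (k + 1)| / sigma T (w k) ^ 2) * ‖P (T (w k))‖
        ≤ ε * |a k| * (|a (k + 1)| / (m * ‖w 0‖ ^ 2)) * (2 * (‖T‖ * √l)) := by
          gcongr
          exact hge k
      _ = D * (|a k| * |a (k + 1)|) := by rw [hD]; ring
      _ ≤ _ := by gcongr
  have hsum := o.summable_sq hlim
  have hcau : CauchySeq v := by
    refine cauchySeq_of_dist_le_of_summable _ hstep ?_
    exact (hsum.add ((summable_nat_add_iff 1).2 hsum)).mul_left D
  obtain ⟨z, hz⟩ := cauchySeq_tendsto_of_complete hcau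
  have hb : Tendsto (fun k => inner ℝ (w k) g) atTop (𝓝 0) := by
    have h1 := (hlim.comp (tendsto_add_atTop_nat 1)).abs.mul_const (√(‖T‖ * l))
    rw [abs_zero, zero_mul] at h1
    refine squeeze_zero_norm (fun k => ?_) h1
    have hs := sigma_pos h (hne k)
    have e : inner ℝ (w k) g = a (k + 1) * sigma T (w k) := by
      rw [ha, phi, div_mul_cancel₀ _ hs.ne']
    rw [e, norm_mul, Real.norm_of_nonneg hs.le, Real.norm_eq_abs]
    simp only [Function.comp]
    gcongr
    refine Real.le_sqrt_of_sq_le ((sigma_sq_le h _).trans ?_)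
    gcongr
    exact hle k
  have hwz : Tendsto w atTop (𝓝 z) := by
    have h1 := hz.add ((hb.div_const (‖g‖ ^ 2)).smul_const g)
    rw [zero_div, zero_smul, add_zero] at h1
    refine h1.congr fun k => ?_
    simp [hv]
  refine ⟨z, ?_, ?_, hwz⟩
  · have := tendsto_nhds_unique hwz.norm hnw
    rw [← norm_pos_iff, this]
    exact hl0
  · have h1 : Tendsto (fun k => inner ℝ (w k) g) atTop (𝓝 (inner ℝ z g)) :=
      hwz.inner tendsto_const_nhds
    exact tendsto_nhds_unique h1 hb

lemma tendsto_minimizer_or_saddle [CompleteSpace E] :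
    (∃ c : ℝ, c ≠ 0 ∧ Tendsto a atTop (𝓝 (phi T (T u) (c • u))) ∧ Tendsto w atTop (𝓝 (c • u))) ∨
    ∃ z ≠ 0, inner ℝ z (T u) = 0 ∧ Tendsto a atTop (𝓝 0) ∧ Tendsto w atTop (𝓝 z) := by
  obtain ⟨A, C, K, c, o⟩ := exists_scalarOrbit h hu hε hw0 ha hw
  obtain ⟨l, hl, hl'⟩ := o.exists_tendsto_a
  have ext : ∀ s : ℝ, (s = 1 ∨ s = -1) → Tendsto a atTop (𝓝 (s * sigma T u)) →
      ∃ c : ℝ, c ≠ 0 ∧ Tendsto a atTop (𝓝 (phi T (T u) (c • u))) ∧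
        Tendsto w atTop (𝓝 (c • u)) := by
    intro s hs hlim
    obtain ⟨c, hc, hcw⟩ := tendsto_of_tendsto_extremal h hu hε hw0 ha hw hs hlim
    refine ⟨c, hc, (tendsto_add_atTop_iff_nat 1).1 ?_, hcw⟩
    simp only [ha]
    exact (continuousAt_phi h _ (smul_ne_zero hc hu)).tendsto.comp hcw
  rcases hl with rfl | rfl | rfl
  · obtain ⟨z, hz, hz', hzw⟩ := tendsto_saddle_of_tendsto_zero h hu hε hw0 ha hw hl'
    exact Or.inr ⟨z, hz, hz', hl', hzw⟩
  · exact Or.inl (ext 1 (Or.inl rfl) (by simpa using hl'))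
  · exact Or.inl (ext (-1) (Or.inr rfl) (by simpa using hl'))

end Orbit

section Dynamics

lemma measure_inter_preimage_eq_zero {X : Type*} [NormedAddCommGroup X] [NormedSpace ℝ X]
    [FiniteDimensional ℝ X] [MeasurableSpace X] [BorelSpace X] (μ : Measure X)
    [μ.IsAddHaarMeasure] {f : X → X} (hf : Measurable f) {O S : Set X}
    (hO : ∀ x ∈ O, ContDiffAt ℝ 1 f x ∧ (fderiv ℝ f x).det ≠ 0) (hS : μ S = 0) :
    μ (O ∩ f ⁻¹' S) = 0 := by
  have : CompleteSpace X := FiniteDimensional.complete ℝ X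
  refine measure_null_of_locally_null _ fun x hx => ?_
  obtain ⟨hd, hdet⟩ := hO x hx.1
  have hstrict : HasStrictFDerivAt f
      ((fderiv ℝ f x).toContinuousLinearEquivOfDetNeZero hdet : X →L[ℝ] X) x := by
    rw [ContinuousLinearMap.coe_toContinuousLinearEquivOfDetNeZero]
    exact hd.hasStrictFDerivAt one_ne_zero
  set e := hstrict.toOpenPartialHomeomorph f with he
  set D := {y | DifferentiableAt ℝ f y}
  set s := e.source ∩ D ∩ f ⁻¹' (toMeasurable μ S) with hs
  have hsm : MeasurableSet s := ((e.open_source.measurableSet).inter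
    (measurableSet_of_differentiableAt ℝ f)).inter (hf (measurableSet_toMeasurable μ S))
  have hinj : Set.InjOn f s := e.injOn.mono fun y hy => hy.1.1
  have hint := lintegral_abs_det_fderiv_eq_addHaar_image μ hsm
    (fun y hy => hy.1.2.hasFDerivAt.hasFDerivWithinAt) hinj
  have hzero : μ (f '' s) = 0 :=
    measure_mono_null (Set.image_subset_iff.2 fun y hy => hy.2) ((measure_toMeasurable S).trans hS)
  rw [hzero, lintegral_eq_zero_iff (by
    exact ENNReal.measurable_ofReal.comp
      ((ContinuousLinearMap.continuous_det.measurable.comp (measurable_fderiv ℝ f)).abs))] at hint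
  have hnull : μ {y ∈ s | (fderiv ℝ f y).det ≠ 0} = 0 := by
    have h1 := ae_iff.1 ((ae_restrict_iff' hsm).1 hint)
    refine measure_mono_null ?_ h1
    intro y hy hcon
    have h2 := hcon hy.1
    simp only [Pi.zero_apply, ENNReal.ofReal_eq_zero] at h2
    exact hy.2 (abs_nonpos_iff.1 h2)
  refine ⟨(O ∩ f ⁻¹' S) ∩ e.source, inter_mem_nhdsWithin _ ?_, measure_mono_null ?_ hnull⟩
  · exact e.open_source.mem_nhds hstrict.mem_toOpenPartialHomeomorph_source
  · rintro y ⟨⟨hyO, hyS⟩, hye⟩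
    exact ⟨⟨⟨hye, (hO y hyO).1.differentiableAt one_ne_zero⟩, subset_toMeasurable μ S hyS⟩,
      (hO y hyO).2⟩

/-- Near a fixed point whose linearization dominates on the cone `‖Q z‖ ≤ |P z|`, two points whose
difference lies in the cone cannot both have their whole orbits nearby. -/
lemma exists_ball_forall_orbit_eq {X Y : Type*} [NormedAddCommGroup X] [NormedSpace ℝ X]
    [NormedAddCommGroup Y] [NormedSpace ℝ Y] {F : X → X} {A : X →L[ℝ] X} {x₀ : X}
    (hF : HasStrictFDerivAt F A x₀) (P : X →L[ℝ] ℝ) (Q : X →L[ℝ] Y) {l ν K : ℝ} (hl : 1 < l)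
    (hν : ν < l) (hν0 : 0 ≤ ν) (hP : ∀ z, P (A z) = l * P z) (hQ : ∀ z, ‖Q (A z)‖ ≤ ν * ‖Q z‖)
    (hK : ∀ z, ‖z‖ ≤ K * max |P z| ‖Q z‖) :
    ∃ r > 0, ∀ x y, (∀ k, F^[k] x ∈ Metric.ball x₀ r) → (∀ k, F^[k] y ∈ Metric.ball x₀ r) →
      ‖Q (x - y)‖ ≤ |P (x - y)| → x = y := by
  set η := min ((l - 1) / 2) ((l - ν) / 2) with hη
  have hη0 : 0 < η := lt_min (by linarith) (by linarith)
  have hη1 : η ≤ (l - 1) / 2 := min_le_left _ _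
  have hη2 : η ≤ (l - ν) / 2 := min_le_right _ _
  set B := |K| * (‖P‖ + ‖Q‖) + 1 with hB
  have hB0 : 0 < B := by positivity
  have hlit := (hasStrictFDerivAt_iff_isLittleO.1 hF).def (c := η / B) (by positivity)
  obtain ⟨r, hr, hball⟩ := Metric.eventually_nhds_iff_ball.1 hlit
  refine ⟨r, hr, fun x y hx hy hxy => ?_⟩
  have cone_norm : ∀ z, ‖Q z‖ ≤ |P z| → ‖z‖ ≤ |K| * |P z| := by
    intro z hz
    have := hK z
    rw [max_eq_left hz] at this
    exact this.trans (by gcongr; exact le_abs_self K)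
  set z : ℕ → X := fun k => F^[k] x - F^[k] y with hz
  have step : ∀ k, ‖Q (z k)‖ ≤ |P (z k)| → ‖Q (z (k + 1))‖ ≤ |P (z (k + 1))| ∧
      (l - η) * |P (z k)| ≤ |P (z (k + 1))| := by
    intro k hk
    set e := F (F^[k] x) - F (F^[k] y) - A (z k) with he
    have hzk : z (k + 1) = A (z k) + e := by
      simp only [hz, he, Function.iterate_succ_apply']; abel
    have hen : ‖e‖ ≤ η / B * ‖z k‖ := hball (F^[k] x, F^[k] y) (by
      rw [← ball_prod_same]; exact ⟨hx k, hy k⟩)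
    have hen' : (‖P‖ + ‖Q‖) * ‖e‖ ≤ η * |P (z k)| := by
      calc (‖P‖ + ‖Q‖) * ‖e‖ ≤ (‖P‖ + ‖Q‖) * (η / B * (|K| * |P (z k)|)) := by
            gcongr; exact hen.trans (by gcongr; exact cone_norm _ hk)
        _ = (|K| * (‖P‖ + ‖Q‖)) / B * (η * |P (z k)|) := by ring
        _ ≤ 1 * (η * |P (z k)|) := by
            gcongr
            rw [div_le_one hB0, hB]; linarith
        _ = _ := one_mul _
    have hPe : |P e| ≤ η * |P (z k)| := by
      have := P.le_opNorm e
      rw [Real.norm_eq_abs] at this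
      nlinarith [mul_nonneg (norm_nonneg Q) (norm_nonneg e)]
    have hQe : ‖Q e‖ ≤ η * |P (z k)| := by
      have := Q.le_opNorm e
      nlinarith [mul_nonneg (norm_nonneg P) (norm_nonneg e)]
    have h1 : (l - η) * |P (z k)| ≤ |P (z (k + 1))| := by
      rw [hzk, map_add, hP]
      have h2 := abs_sub_abs_le_abs_sub (l * P (z k)) (-P e)
      rw [abs_neg, sub_neg_eq_add, abs_mul, abs_of_pos (by linarith : 0 < l)] at h2
      linarith
    refine ⟨le_trans ?_ h1, h1⟩
    rw [hzk, map_add]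
    refine (norm_add_le _ _).trans ?_
    have h3 := (hQ (z k)).trans (mul_le_mul_of_nonneg_left hk hν0)
    have h4 : (ν + η) * |P (z k)| ≤ (l - η) * |P (z k)| := by gcongr; linarith
    linarith
  have hcone : ∀ k, ‖Q (z k)‖ ≤ |P (z k)| := by
    intro k
    induction k with
    | zero => exact hxy
    | succ k ih => exact (step k ih).1
  have hgrow : ∀ k, (l - η) ^ k * |P (z 0)| ≤ |P (z k)| := by
    intro k
    induction k with
    | zero => simp
    | succ k ih =>
      have h5 : 0 ≤ l - η := by linarith
      calc (l - η) ^ (k + 1) * |P (z 0)| = (l - η) * ((l - η) ^ k * |P (z 0)|) := by ring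
        _ ≤ (l - η) * |P (z k)| := by gcongr
        _ ≤ _ := (step k (hcone k)).2
  have hbdd : ∀ k, |P (z k)| ≤ ‖P‖ * (r + r) := by
    intro k
    refine (P.le_opNorm _).trans ?_
    gcongr
    rw [hz, ← dist_eq_norm]
    exact (dist_triangle_right _ _ x₀).trans
      (add_le_add (Metric.mem_ball.1 (hx k)).le (Metric.mem_ball.1 (hy k)).le)
  have hP0 : |P (z 0)| = 0 := by
    by_contra hne
    have hpos : 0 < |P (z 0)| := lt_of_le_of_ne (abs_nonneg _) (Ne.symm hne)
    have ht := (tendsto_pow_atTop_atTop_of_one_lt (by linarith : 1 < l - η)).atTop_mul_const hpos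
    obtain ⟨k, hk⟩ := (ht.eventually_gt_atTop (‖P‖ * (r + r))).exists
    linarith [hgrow k, hbdd k]
  have := cone_norm _ (hcone 0)
  rw [hP0, mul_zero, norm_le_zero_iff] at this
  exact sub_eq_zero.1 this

end Dynamics

section Smooth

variable {E : Type*} [NormedAddCommGroup E] [InnerProductSpace ℝ E]
  {T : E →L[ℝ] E} {m : ℝ} (h : SymmCoercive T m) (g : E)

include h

lemma contDiffAt_sigma {w : E} (hw : w ≠ 0) : ContDiffAt ℝ 1 (sigma T) w := by
  unfold sigma
  refine ContDiffAt.sqrt (contDiffAt_id.inner ℝ T.contDiff.contDiffAt) ?_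
  rw [← sigma_sq h]
  exact (pow_pos (sigma_pos h hw) 2).ne'

lemma contDiffAt_gradPhi {w : E} (hw : w ≠ 0) : ContDiffAt ℝ 1 (gradPhi T g) w := by
  have h1 := contDiffAt_sigma h hw
  have h2 := (sigma_pos h hw).ne'
  unfold gradPhi
  refine (h1.inv h2).smul (contDiffAt_const.sub (ContDiffAt.smul ?_ (by fun_prop)))
  exact ContDiffAt.div (contDiffAt_id.inner ℝ contDiffAt_const) (h1.pow 2) (pow_ne_zero 2 h2)

lemma contDiffAt_phi {w : E} (hw : w ≠ 0) : ContDiffAt ℝ 1 (phi T g) w := by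
  unfold phi
  exact (contDiffAt_id.inner ℝ contDiffAt_const).div (contDiffAt_sigma h hw) (sigma_pos h hw).ne'

lemma hasFDerivAt_phi {w : E} (hw : w ≠ 0) :
    HasFDerivAt (phi T g) (innerSL ℝ (gradPhi T g w)) w := by
  have hs := sigma_pos h hw
  have hq : HasFDerivAt (fun x => inner ℝ x (T x)) ((2 : ℝ) • innerSL ℝ (T w)) w := by
    refine ((hasFDerivAt_id w).inner ℝ (T.hasFDerivAt (x := w))).congr_fderiv ?_
    ext y
    simp [fderivInnerCLM_apply, inner_apply_comm h w y, real_inner_comm]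
    ring
  have hσ : HasFDerivAt (sigma T) ((1 / (2 * sigma T w)) • (2 : ℝ) • innerSL ℝ (T w)) w :=
    hq.sqrt (by rw [← sigma_sq h]; positivity)
  have hb : HasFDerivAt (fun x => inner ℝ x g) (innerSL ℝ g) w := by
    refine ((innerSL ℝ g).hasFDerivAt (x := w)).congr_of_eventuallyEq ?_
    exact Eventually.of_forall fun x => by simp [real_inner_comm]
  have hinv := (hasDerivAt_inv hs.ne').comp_hasFDerivAt w hσ
  have hφ := hb.mul hinv
  refine (hφ.congr_fderiv ?_).congr_of_eventuallyEq
    (Eventually.of_forall fun x => by simp [phi, div_eq_mul_inv])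
  ext y
  simp only [gradPhi, _root_.add_apply, _root_.smul_apply,
    innerSL_apply_apply, smul_eq_mul, inner_smul_left, inner_sub_left, RCLike.conj_to_real, Function.comp]
  field_simp
  ring

variable (ε : ℝ)

lemma contDiffAt_bnStep {p : ℝ × E} (hp : p.2 ≠ 0) : ContDiffAt ℝ 1 (bnStep T g ε) p := by
  have h1 : ContDiffAt ℝ 1 (fun q : ℝ × E => phi T g q.2) p :=
    (contDiffAt_phi h g hp).comp p contDiffAt_snd
  have h2 : ContDiffAt ℝ 1 (fun q : ℝ × E => gradPhi T g q.2) p :=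
    (contDiffAt_gradPhi h g hp).comp p contDiffAt_snd
  unfold bnStep
  exact h1.prodMk (contDiffAt_snd.add (ContDiffAt.smul (by fun_prop) h2))

lemma fderiv_bnStep_apply {p : ℝ × E} (hp : p.2 ≠ 0) (z : ℝ × E) :
    fderiv ℝ (bnStep T g ε) p z = (inner ℝ (gradPhi T g p.2) z.2,
      z.2 + ((ε * p.1) • fderiv ℝ (gradPhi T g) p.2 z.2 + (ε * z.1) • gradPhi T g p.2)) := by
  have h1 : HasFDerivAt (fun q : ℝ × E => phi T g q.2) _ p :=
    HasFDerivAt.comp p (hasFDerivAt_phi h g hp) hasFDerivAt_snd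
  have h2 : HasFDerivAt (fun q : ℝ × E => gradPhi T g q.2) _ p :=
    HasFDerivAt.comp p (((contDiffAt_gradPhi h g hp).differentiableAt one_ne_zero).hasFDerivAt)
      hasFDerivAt_snd
  have h3 : HasFDerivAt (fun q : ℝ × E => ε * q.1) (ε • ContinuousLinearMap.fst ℝ ℝ E) p :=
    (hasFDerivAt_fst (𝕜 := ℝ) (p := p)).const_mul ε
  have h4 := h1.prodMk (hasFDerivAt_snd.add (h3.smul h2))
  have h5 : HasFDerivAt (bnStep T g ε) _ p := h4
  rw [h5.fderiv]
  simp

omit h in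
lemma measurable_gradPhi [FiniteDimensional ℝ E] [MeasurableSpace E] [BorelSpace E] :
    Measurable (gradPhi T g) := by
  have hs : Measurable (sigma T) := (continuous_sigma T).measurable
  have hb : Measurable fun x => inner ℝ x g :=
    (continuous_id.inner continuous_const).measurable
  exact hs.inv.smul (measurable_const.sub ((hb.div (hs.pow_const 2)).smul T.continuous.measurable))

omit h in
lemma measurable_bnStep [FiniteDimensional ℝ E] [MeasurableSpace E] [BorelSpace E] :
    Measurable (bnStep T g ε) := by
  have hb : Measurable fun x => inner ℝ x g := (continuous_id.inner continuous_const).measurable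
  exact ((hb.div (continuous_sigma T).measurable).comp measurable_snd).prodMk
    (measurable_snd.add ((measurable_fst.const_mul ε).smul
      ((measurable_gradPhi g).comp measurable_snd)))

lemma finite_setOf_det_eq_zero [FiniteDimensional ℝ E] (hε : 0 < ε) {w : E} (hw : w ≠ 0)
    (hN : gradPhi T g w ≠ 0) : {a : ℝ | (fderiv ℝ (bnStep T g ε) (a, w)).det = 0}.Finite := by
  set N := gradPhi T g w
  set S := fderiv ℝ (gradPhi T g) w
  set R : Module.End ℝ E := ((S - ContinuousLinearMap.smulRight ((innerSL ℝ N).comp S)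
    ((‖N‖ ^ 2)⁻¹ • N) : E →L[ℝ] E) : E →ₗ[ℝ] E)
  have hR : ∀ x, R x = S x - inner ℝ N (S x) • (‖N‖ ^ 2)⁻¹ • N := fun x => rfl
  have hNn := norm_pos_iff.2 hN
  refine ((Module.End.finite_hasEigenvalue R).image fun μ => -(ε * μ)⁻¹).subset fun a ha => ?_
  obtain ⟨⟨α, ω⟩, hz, hz0⟩ := (Submodule.ne_bot_iff _).1
    (LinearMap.det_eq_zero_iff_ker_ne_bot.1 ha)
  have hz1 : fderiv ℝ (bnStep T g ε) (a, w) (α, ω) = 0 := hz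
  rw [fderiv_bnStep_apply h g ε (by exact hw), Prod.mk_eq_zero] at hz1
  obtain ⟨e1, e2⟩ := hz1
  dsimp only at e1 e2
  have e3 := congrArg (inner ℝ N) e2
  rw [inner_add_right, inner_add_right, e1, inner_smul_right, inner_smul_right, inner_zero_right,
    real_inner_self_eq_norm_sq, zero_add] at e3
  have e4 : α = -(a * inner ℝ N (S ω) / ‖N‖ ^ 2) := by
    field_simp
    have : ε * (a * inner ℝ N (S ω) + α * ‖N‖ ^ 2) = 0 := by linear_combination e3
    linarith [(mul_eq_zero.1 this).resolve_left hε.ne']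
  have e5 : ω = -((ε * a) • R ω) := by
    rw [← sub_eq_zero, ← e2, hR, e4]
    match_scalars <;> field_simp
  have hω : ω ≠ 0 := by
    rintro rfl
    apply hz0
    rw [e4]; simp
  have ha0 : a ≠ 0 := by
    rintro rfl
    apply hω
    rw [e5]; simp
  refine ⟨-(ε * a)⁻¹, Module.End.hasEigenvalue_of_hasEigenvector (x := ω)
    ⟨Module.End.mem_eigenspace_iff.2 ?_, hω⟩, ?_⟩
  · conv_rhs => rw [e5]
    rw [smul_neg, neg_smul, neg_neg, smul_smul, inv_mul_cancel₀ (by positivity), one_smul]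
  · field_simp

lemma exists_ball_saddle (hε : 0 < ε) [FiniteDimensional ℝ E] {z : E} (hz : z ≠ 0)
    (hzg : inner ℝ z g = 0) (hg : g ≠ 0) :
    ∃ r > 0, ∀ a b w, (∀ k, (bnStep T g ε)^[k] (a, w) ∈ Metric.ball (0, z) r) →
      (∀ k, (bnStep T g ε)^[k] (b, w) ∈ Metric.ball (0, z) r) → a = b := by
  have hs := sigma_pos h hz
  set N := gradPhi T g z with hNdef
  have hN : N ≠ 0 := by
    rw [hNdef, gradPhi, hzg, zero_div, zero_smul, sub_zero]
    exact smul_ne_zero (inv_ne_zero hs.ne') hg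
  have hNn := norm_pos_iff.2 hN
  set κ := ε * ‖N‖ ^ 2 with hκ
  have hκ0 : 0 < κ := by positivity
  obtain ⟨l, hl, hlκ⟩ : ∃ l : ℝ, 1 < l ∧ l * (l - 1) = κ := by
    refine ⟨(1 + √(1 + 4 * κ)) / 2, ?_, ?_⟩
    · have : 1 < √(1 + 4 * κ) := Real.lt_sqrt_of_sq_lt (by linarith)
      linarith
    · have := Real.sq_sqrt (by positivity : 0 ≤ 1 + 4 * κ)
      nlinarith
  set A := fderiv ℝ (bnStep T g ε) (0, z) with hA
  have hAz : ∀ x, A x = (inner ℝ N x.2, x.2 + (ε * x.1) • N) := fun x => by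
    rw [hA, fderiv_bnStep_apply h g ε (by exact hz)]; simp [hNdef]
  have hstrict : HasStrictFDerivAt (bnStep T g ε) A (0, z) :=
    (contDiffAt_bnStep h g ε (by exact hz)).hasStrictFDerivAt one_ne_zero
  set b : ℝ × E →L[ℝ] ℝ := (innerSL ℝ N).comp (ContinuousLinearMap.snd ℝ ℝ E) with hb
  set P : ℝ × E →L[ℝ] ℝ := (l - 1) • ContinuousLinearMap.fst ℝ ℝ E + b
  have hPx : ∀ x, P x = (l - 1) * x.1 + inner ℝ N x.2 := fun x => rfl
  set Q : ℝ × E →L[ℝ] ℝ × E := (((l - 1) / l) • (b - l • ContinuousLinearMap.fst ℝ ℝ E)).prod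
    (ContinuousLinearMap.snd ℝ ℝ E - b.smulRight ((‖N‖ ^ 2)⁻¹ • N))
  have hQx : ∀ x, Q x = ((l - 1) / l * (inner ℝ N x.2 - l * x.1),
    x.2 - inner ℝ N x.2 • (‖N‖ ^ 2)⁻¹ • N) := fun x => rfl
  obtain ⟨K, -, hK⟩ := ((P.prod Q : ℝ × E →L[ℝ] ℝ × (ℝ × E)) :
      ℝ × E →ₗ[ℝ] ℝ × (ℝ × E)).exists_antilipschitzWith (by
    rw [LinearMap.ker_eq_bot']
    rintro ⟨α, ω⟩ hx
    have hx' : (P (α, ω), Q (α, ω)) = 0 := hx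
    rw [hPx, hQx, Prod.mk_eq_zero, Prod.mk_eq_zero] at hx'
    obtain ⟨e1, e2, e3⟩ := hx'
    dsimp only at e1 e2 e3
    have e4 := (mul_eq_zero.1 e2).resolve_left (by
      have : 0 < l - 1 := by linarith
      positivity)
    have e5 : α = 0 := by
      have : (2 * l - 1) * α = 0 := by linear_combination e1 - e4
      exact (mul_eq_zero.1 this).resolve_left (by linarith)
    have e6 : inner ℝ N ω = 0 := by rw [e5] at e1; linarith
    rw [e6, zero_smul, sub_zero] at e3
    rw [e5, e3]; rfl)
  have hP : ∀ x, P (A x) = l * P x := by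
    intro x
    rw [hAz, hPx, hPx]
    simp only [inner_add_right, inner_smul_right, real_inner_self_eq_norm_sq]
    linear_combination (-x.1) * hlκ
  have hQ : ∀ x, ‖Q (A x)‖ ≤ max 1 (l - 1) * ‖Q x‖ := by
    intro x
    have e : Q (A x) = ((1 - l) * (Q x).1, (Q x).2) := by
      rw [hAz, hQx, hQx]
      simp only [inner_add_right, inner_smul_right, real_inner_self_eq_norm_sq]
      congr 1
      · field_simp
        linear_combination (-((l - 1) * x.1)) * hlκ
      · match_scalars <;> field_simp
        ring
    rw [e, Prod.norm_mk, Prod.norm_def (x := Q x), norm_mul, Real.norm_eq_abs, abs_sub_comm,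
      abs_of_pos (by linarith : 0 < l - 1)]
    refine max_le ?_ ?_
    · exact mul_le_mul (le_max_right _ _) (le_max_left _ _) (norm_nonneg _) (by positivity)
    · calc ‖(Q x).2‖ ≤ 1 * max ‖(Q x).1‖ ‖(Q x).2‖ := by rw [one_mul]; exact le_max_right _ _
        _ ≤ _ := by gcongr; exact le_max_left _ _
  have hPQ : ∀ x, ‖x‖ ≤ K * max |P x| ‖Q x‖ := by
    intro x
    have := hK.le_mul_dist x 0
    rw [map_zero, dist_zero_right, dist_zero_right] at this
    exact this
  obtain ⟨r, hr, hball⟩ := exists_ball_forall_orbit_eq hstrict P Q hl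
    (max_lt hl (by linarith)) (by positivity) hP hQ hPQ
  refine ⟨r, hr, fun a₁ a₂ w h1 h2 => ?_⟩
  refine congrArg Prod.fst (hball _ _ h1 h2 ?_)
  rw [hPx, hQx]
  simp only [Prod.fst_sub, Prod.snd_sub, sub_self, inner_zero_right, zero_smul, add_zero, zero_sub,
    Prod.norm_mk, norm_zero, Real.norm_eq_abs]
  have hl0 : 0 < l := by linarith
  refine max_le (le_of_eq ?_) (abs_nonneg _)
  rw [show (l - 1) / l * -(l * (a₁ - a₂)) = -((l - 1) * (a₁ - a₂)) by field_simp, abs_neg]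

lemma tendsto_of_gradPhi_iterate_eq_zero {u : E} (hu : u ≠ 0) {p : ℝ × E} {j : ℕ}
    (hj : ((bnStep T (T u) ε)^[j] p).2 ≠ 0)
    (hN : gradPhi T (T u) ((bnStep T (T u) ε)^[j] p).2 = 0) :
    ∃ c : ℝ, c ≠ 0 ∧
      Tendsto (fun k => ((bnStep T (T u) ε)^[k] p).1) atTop (𝓝 (phi T (T u) (c • u))) ∧
      Tendsto (fun k => ((bnStep T (T u) ε)^[k] p).2) atTop (𝓝 (c • u)) := by
  set q := (bnStep T (T u) ε)^[j] p with hq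
  have hconst : ∀ k, ((bnStep T (T u) ε)^[k] q).2 = q.2 := by
    intro k
    induction k with
    | zero => rfl
    | succ k ih =>
      rw [Function.iterate_succ_apply']
      simp only [bnStep] at ih ⊢
      rw [ih, hN, smul_zero, add_zero]
  have hstep : ∀ k, (bnStep T (T u) ε)^[k + 1] q = (phi T (T u) q.2, q.2) := by
    intro k
    refine Prod.ext ?_ (hconst _)
    rw [Function.iterate_succ_apply']
    exact congrArg (phi T (T u)) (hconst k)
  have hus := eq_smul_of_gradPhi_eq_zero h hj hN
  set s := phi T (T u) q.2 / sigma T q.2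
  have hs : s ≠ 0 := by
    intro hs
    rw [hs, zero_smul] at hus
    exact hu hus
  have hqu : s⁻¹ • u = q.2 := by rw [hus, inv_smul_smul₀ hs]
  refine ⟨s⁻¹, inv_ne_zero hs, ?_, ?_⟩ <;>
  · rw [hqu]
    refine (tendsto_add_atTop_iff_nat (1 + j)).1 (tendsto_const_nhds.congr fun k => ?_)
    rw [← add_assoc, Function.iterate_add_apply, ← hq, hstep]

end Smooth

section NullSets

variable {E : Type*} [NormedAddCommGroup E] [InnerProductSpace ℝ E] [FiniteDimensional ℝ E]
  [MeasurableSpace E] [BorelSpace E]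

lemma volume_eq_zero_of_slices {s : Set (ℝ × E)} (hs : MeasurableSet s)
    (hfin : ∀ w, {a | (a, w) ∈ s}.Finite) : volume s = 0 := by
  rw [Measure.volume_eq_prod, Measure.prod_apply_symm hs]
  refine (lintegral_congr fun w => ?_).trans lintegral_zero
  exact (hfin w).measure_zero volume

variable {T : E →L[ℝ] E} {m : ℝ} (h : SymmCoercive T m) (g : E) {ε : ℝ} (hε : 0 < ε)

/-- The states whose direction is not already critical. -/
def movingStates (T : E →L[ℝ] E) (g : E) : Set (ℝ × E) := {p | p.2 ≠ 0 ∧ gradPhi T g p.2 ≠ 0}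

lemma measurableSet_movingStates : MeasurableSet (movingStates T g) :=
  (measurable_snd (measurableSet_singleton (0 : E)).compl).inter
    (((measurable_gradPhi g).comp measurable_snd) (measurableSet_singleton (0 : E)).compl)

include h hε

lemma volume_movingStates_inter_preimage {S : Set (ℝ × E)} (hS : volume S = 0) :
    volume (movingStates T g ∩ bnStep T g ε ⁻¹' S) = 0 := by
  have hhaar : (volume : Measure (ℝ × E)).IsAddHaarMeasure :=
    inferInstanceAs (volume.prod volume).IsAddHaarMeasure
  set Z : Set (ℝ × E) := movingStates T g ∩ {p | (fderiv ℝ (bnStep T g ε) p).det = 0}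
  have hZ : volume Z = 0 := by
    refine volume_eq_zero_of_slices ((measurableSet_movingStates g).inter
      ((ContinuousLinearMap.continuous_det.measurable.comp (measurable_fderiv ℝ _))
        (measurableSet_singleton (0 : ℝ)))) fun w => ?_
    by_cases hw : w ≠ 0 ∧ gradPhi T g w ≠ 0
    · exact (finite_setOf_det_eq_zero h g ε hε hw.1 hw.2).subset fun a ha => ha.2
    · exact Set.finite_empty.subset fun a ha => hw ha.1
  have hmain := measure_inter_preimage_eq_zero volume (measurable_bnStep g ε)
    (O := movingStates T g \ Z) (fun p hp => ⟨contDiffAt_bnStep h g ε hp.1.1,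
      fun h0 => hp.2 ⟨hp.1, h0⟩⟩) hS
  refine measure_mono_null (fun p hp => ?_) (measure_union_null hZ hmain)
  by_cases hpZ : p ∈ Z
  · exact Or.inl hpZ
  · exact Or.inr ⟨⟨hp.1, hpZ⟩, hp.2⟩

lemma exists_null_trap (hg : g ≠ 0) : ∃ W : Set (ℝ × E), volume W = 0 ∧
    ∀ z ≠ 0, inner ℝ z g = 0 → ∀ p, Tendsto (fun k => (bnStep T g ε)^[k] p) atTop (𝓝 (0, z)) →
      ∃ k, (bnStep T g ε)^[k] p ∈ W := by
  set S : Set (ℝ × E) := {x | x.1 = 0 ∧ x.2 ≠ 0 ∧ inner ℝ x.2 g = 0}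
  have hex : ∀ x : ℝ × E, ∃ r > 0, x ∈ S → ∀ a b w,
      (∀ k, (bnStep T g ε)^[k] (a, w) ∈ Metric.ball x r) →
      (∀ k, (bnStep T g ε)^[k] (b, w) ∈ Metric.ball x r) → a = b := by
    rintro ⟨x, z⟩
    by_cases hx : (x, z) ∈ S
    · obtain ⟨rfl, hz, hzg⟩ := hx
      obtain ⟨r, hr, hr'⟩ := exists_ball_saddle h g ε hε hz hzg hg
      exact ⟨r, hr, fun _ => hr'⟩
    · exact ⟨1, one_pos, fun hx' => absurd hx' hx⟩
  choose r hr hball using hex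
  obtain ⟨t, htS, htc, hcov⟩ := TopologicalSpace.countable_cover_nhdsWithin (s := S)
    (f := fun x => Metric.ball x (r x)) fun x _ =>
      mem_nhdsWithin_of_mem_nhds (Metric.ball_mem_nhds x (hr x))
  refine ⟨⋃ x ∈ t, {p | ∀ k, (bnStep T g ε)^[k] p ∈ Metric.ball x (r x)},
    (measure_biUnion_null_iff htc).2 fun x hx => ?_, fun z hz hzg p hp => ?_⟩
  · refine volume_eq_zero_of_slices ?_ fun w => ?_
    · rw [Set.ofPred_forall]
      exact MeasurableSet.iInter fun k =>
        ((measurable_bnStep g ε).iterate k) Metric.isOpen_ball.measurableSet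
    · exact Set.Subsingleton.finite fun a ha b hb => hball x (htS hx) a b w ha hb
  · obtain ⟨x, hx, hzx⟩ := Set.mem_iUnion₂.1 (hcov (show ((0 : ℝ), z) ∈ S from ⟨rfl, hz, hzg⟩))
    obtain ⟨k, hk⟩ := eventually_atTop.1 (hp.eventually_mem (Metric.isOpen_ball.mem_nhds hzx))
    refine ⟨k, Set.mem_iUnion₂.2 ⟨x, hx, fun j => ?_⟩⟩
    rw [← Function.iterate_add_apply]
    exact hk _ (Nat.le_add_left k j)

theorem volume_setOf_not_tendsto_minimizer {u : E} (hu : u ≠ 0) :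
    volume {p : ℝ × E | p.2 ≠ 0 ∧ ¬ ∃ c : ℝ, c ≠ 0 ∧
      Tendsto (fun k => ((bnStep T (T u) ε)^[k] p).1) atTop (𝓝 (phi T (T u) (c • u))) ∧
      Tendsto (fun k => ((bnStep T (T u) ε)^[k] p).2) atTop (𝓝 (c • u))} = 0 := by
  have hg : T u ≠ 0 := by
    intro h0
    have h1 := sigma_sq h u
    rw [h0, inner_zero_right] at h1
    exact (pow_pos (sigma_pos h hu) 2).ne' h1
  obtain ⟨W, hW, htrap⟩ := exists_null_trap h (T u) hε hg
  let B : ℕ → Set (ℝ × E) := fun k =>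
    (fun S => movingStates T (T u) ∩ bnStep T (T u) ε ⁻¹' S)^[k] W
  have hBsucc : ∀ k, B (k + 1) = movingStates T (T u) ∩ bnStep T (T u) ε ⁻¹' B k :=
    fun k => Function.iterate_succ_apply' _ _ _
  have hB : ∀ k, volume (B k) = 0 := by
    intro k
    induction k with
    | zero => exact hW
    | succ k ih =>
      rw [hBsucc]
      exact volume_movingStates_inter_preimage h (T u) hε ih
  have hmem : ∀ k p, (∀ j, (bnStep T (T u) ε)^[j] p ∈ movingStates T (T u)) →
      (bnStep T (T u) ε)^[k] p ∈ W → p ∈ B k := by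
    intro k
    induction k with
    | zero => exact fun p _ hp => hp
    | succ k ih =>
      intro p hp hpW
      rw [hBsucc]
      exact ⟨hp 0, ih _ (fun j => hp (j + 1)) hpW⟩
  refine measure_mono_null (fun p hp => ?_) (measure_iUnion_null hB)
  obtain ⟨hp0, hp⟩ := hp
  have ha : ∀ k, ((bnStep T (T u) ε)^[k + 1] p).1 =
      phi T (T u) ((bnStep T (T u) ε)^[k] p).2 := fun k => by
    rw [Function.iterate_succ_apply']; rfl
  have hw : ∀ k, ((bnStep T (T u) ε)^[k + 1] p).2 = ((bnStep T (T u) ε)^[k] p).2 +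
      (ε * ((bnStep T (T u) ε)^[k] p).1) • gradPhi T (T u) ((bnStep T (T u) ε)^[k] p).2 :=
    fun k => by rw [Function.iterate_succ_apply']; rfl
  have hne : ∀ k, ((bnStep T (T u) ε)^[k] p).2 ≠ 0 :=
    orbit_ne_zero h (w := fun k => ((bnStep T (T u) ε)^[k] p).2) hp0 hw
  have : CompleteSpace E := FiniteDimensional.complete ℝ E
  rcases tendsto_minimizer_or_saddle h hu hε (a := fun k => ((bnStep T (T u) ε)^[k] p).1)
    (w := fun k => ((bnStep T (T u) ε)^[k] p).2) hp0 ha hw with hmin | ⟨z, hz, hzg, haz, hwz⟩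
  · exact absurd hmin hp
  · obtain ⟨k, hk⟩ := htrap z hz hzg p (haz.prodMk_nhds hwz)
    refine Set.mem_iUnion.2 ⟨k, hmem k p (fun j => ⟨hne j, fun hN => hp ?_⟩) hk⟩
    exact tendsto_of_gradPhi_iterate_eq_zero h ε hu (hne j) hN

end NullSets

section Matrix

lemma exists_symmCoercive {E : Type*} [NormedAddCommGroup E] [InnerProductSpace ℝ E]
    [FiniteDimensional ℝ E] {T : E →L[ℝ] E} (hsymm : ∀ x y, inner ℝ (T x) y = inner ℝ x (T y))
    (hpos : ∀ x ≠ 0, 0 < inner ℝ x (T x)) : ∃ m, SymmCoercive T m := by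
  obtain ⟨m, hm, hmin⟩ := (isCompact_sphere (0 : E) 1).exists_forall_le'
    (f := fun x => inner ℝ x (T x)) (a := 0) (by fun_prop)
    fun x hx => hpos x (ne_zero_of_mem_unit_sphere ⟨x, hx⟩)
  refine ⟨m, hm, hsymm, fun x => ?_⟩
  obtain rfl | hx := eq_or_ne x 0
  · simp
  · have hn := norm_pos_iff.2 hx
    have := hmin (‖x‖⁻¹ • x) (by simp [norm_smul, hn.ne'])
    rw [map_smul, inner_smul_left, inner_smul_right, RCLike.conj_to_real] at this
    field_simp at this
    linarith

lemma exists_symmCoercive_toEuclideanCLM {d : ℕ} {H : Matrix (Fin d) (Fin d) ℝ} (hH : H.PosDef) :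
    ∃ m, SymmCoercive (toEuclideanCLM (𝕜 := ℝ) H) m := by
  refine exists_symmCoercive (fun x y => ?_) fun x hx => ?_
  · rw [real_inner_comm, inner_toEuclideanCLM, inner_toEuclideanCLM, dotProduct_mulVec,
      ← mulVec_transpose, ← conjTranspose_eq_transpose_of_trivial, hH.isHermitian.eq,
      dotProduct_comm]
  · rw [inner_toEuclideanCLM]
    have hx' : x.ofLp ≠ 0 := by simpa using hx
    simpa using hH.dotProduct_mulVec_pos hx'

end Matrix

end BNGD

/-- Almost-sure convergence to global minimizers for `ε_a = 1`: the set of initial values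
`(a₀, w₀) ∈ ℝ × (ℝ^d \ {0})` whose BNGD iterates do not converge to a global minimizer
of the BN-OLS objective has Lebesgue measure zero. -/
theorem bngd_measure_zero_nonminimizer_initials
    {d : ℕ} (hd : 0 < d)
    (H : Matrix (Fin d) (Fin d) ℝ) (hH : H.PosDef)
    (u : Fin d → ℝ) (hu : u ≠ 0)
    (εa ε : ℝ) (hεa : εa = 1) (hε : 0 < ε)
    (g : Fin d → ℝ) (hg : g = H.mulVec u)
    (σ : (Fin d → ℝ) → ℝ) (hσ : ∀ v, σ v = Real.sqrt (v ⬝ᵥ H.mulVec v))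
    (step : ℝ × (Fin d → ℝ) → ℝ × (Fin d → ℝ))
    (hstep : ∀ p : ℝ × (Fin d → ℝ), step p =
      (p.1 + εa * ((p.2 ⬝ᵥ g) / σ p.2 - p.1),
        p.2 + (ε * (p.1 / σ p.2)) • (g - ((p.2 ⬝ᵥ g) / (σ p.2) ^ 2) • H.mulVec p.2))) :
    volume {p : ℝ × (Fin d → ℝ) | p.2 ≠ 0 ∧
      ¬ ∃ (astar : ℝ) (wstar : Fin d → ℝ) (c : ℝ), c ≠ 0 ∧ wstar = c • u ∧
          astar = (wstar ⬝ᵥ g) / σ wstar ∧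
          Tendsto (fun k => (step^[k] p).1) atTop (nhds astar) ∧
          Tendsto (fun k => (step^[k] p).2) atTop (nhds wstar)} = 0 := by
  subst hεa hg
  obtain ⟨m, h⟩ := BNGD.exists_symmCoercive_toEuclideanCLM hH
  set T := toEuclideanCLM (𝕜 := ℝ) H
  set v : EuclideanSpace ℝ (Fin d) := WithLp.toLp 2 u
  have hv : v ≠ 0 := by simpa [v] using hu
  have hinner : ∀ x y : EuclideanSpace ℝ (Fin d), inner ℝ x y = x.ofLp ⬝ᵥ y.ofLp := fun x y => by
    rw [EuclideanSpace.inner_eq_star_dotProduct, star_trivial, dotProduct_comm]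
  have hT : ∀ x, (T x).ofLp = H *ᵥ x.ofLp := fun x => rfl
  have hsigma : ∀ x, σ x = BNGD.sigma T (WithLp.toLp 2 x) := fun x => by
    rw [hσ, BNGD.sigma, hinner, hT]
  have hphi : ∀ x, BNGD.phi T (T v) (WithLp.toLp 2 x) = (x ⬝ᵥ H *ᵥ u) / σ x := fun x => by
    rw [BNGD.phi, hinner, hT, hsigma]
  set L : ℝ × (Fin d → ℝ) → ℝ × EuclideanSpace ℝ (Fin d) := Prod.map id (WithLp.toLp 2)
  have hL : MeasurePreserving L := (MeasurePreserving.id volume).prod (PiLp.volume_preserving_toLp _)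
  have hsemi : Function.Semiconj L step (BNGD.bnStep T (T v) ε) := fun p => by
    rw [hstep]
    refine Prod.ext ?_ ?_
    · simp [L, BNGD.bnStep, hphi]
    · apply WithLp.ofLp_injective 2
      simp only [L, BNGD.bnStep, BNGD.gradPhi, Prod.map, id, WithLp.ofLp_add, WithLp.ofLp_smul,
        WithLp.ofLp_sub, hinner, hT, ← hsigma, smul_smul, div_eq_mul_inv, mul_assoc, v]
  have hiter : ∀ k p, (BNGD.bnStep T (T v) ε)^[k] (L p) = L (step^[k] p) := fun k p =>
    ((hsemi.iterate_right k) p).symm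
  refine measure_mono_null (fun p hp => ?_)
    (hL.quasiMeasurePreserving.preimage_null (BNGD.volume_setOf_not_tendsto_minimizer h hε hv))
  refine ⟨fun h0 => hp.1 (WithLp.toLp_injective 2 h0), fun ⟨c, hc, ha, hw⟩ => hp.2 ?_⟩
  simp only [hiter] at ha hw
  refine ⟨_, c • u, c, hc, rfl, rfl, ?_, ?_⟩
  · rw [← hphi]
    exact ha
  · exact ((PiLp.continuous_ofLp 2 _).tendsto _).comp hw
end
end

section
/- Linear convergence rate of BNGD near a minimizer: Suppose the BNGD iterates (a_k, w_k) converge to a global minimizer of the BN-OLS objective and the limiting effective step size ε̂ := lim_{k→∞} ε̂_k satisfies ε̂ < 2/λ*_max, where λ*_max is the largest eigenvalue of H* := H − (Huuᵀ H)/(uᵀHu). Then the residuals e_k := u − (w_kᵀg/σ(w_k)²)w_k converge to 0 linearly: there exist C > 0 and ρ̂ ∈ (0, 1) such that ‖e_k‖_H ≤ C·ρ̂^k for all k. -/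
open Matrix Filter Topology

noncomputable section

theorem dotProduct_mulVec_comm_of_isHermitian {n : Type*} [Fintype n] {A : Matrix n n ℝ}
    (hA : A.IsHermitian) (x y : n → ℝ) : x ⬝ᵥ A *ᵥ y = y ⬝ᵥ A *ᵥ x := by
  have hT : Aᵀ = A := by simpa [Matrix.IsHermitian, conjTranspose_eq_transpose_of_trivial] using hA
  rw [dotProduct_mulVec, ← mulVec_transpose, hT, dotProduct_comm]

theorem sum_dotProduct_eigenvectorBasis {n : Type*} [Fintype n] [DecidableEq n]
    {A : Matrix n n ℝ} (hA : A.IsHermitian) (x y : n → ℝ) :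
    ∑ i, ((hA.eigenvectorBasis i).ofLp ⬝ᵥ x) * ((hA.eigenvectorBasis i).ofLp ⬝ᵥ y) = x ⬝ᵥ y := by
  have h := hA.eigenvectorBasis.sum_inner_mul_inner (WithLp.toLp 2 x) (WithLp.toLp 2 y)
  simp only [EuclideanSpace.inner_eq_star_dotProduct, star_trivial] at h
  rw [dotProduct_comm x y, ← h]
  refine Finset.sum_congr rfl fun i _ => ?_
  rw [dotProduct_comm y]

theorem eigenvectorBasis_dotProduct_mulVec {n : Type*} [Fintype n] [DecidableEq n]
    {A : Matrix n n ℝ} (hA : A.IsHermitian) (x : n → ℝ) (i : n) :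
    (hA.eigenvectorBasis i).ofLp ⬝ᵥ A *ᵥ x =
      hA.eigenvalues i * ((hA.eigenvectorBasis i).ofLp ⬝ᵥ x) := by
  rw [dotProduct_mulVec_comm_of_isHermitian hA, hA.mulVec_eigenvectorBasis, dotProduct_smul,
    smul_eq_mul, dotProduct_comm]

/-- One step of gradient descent on the quadratic form of `A` contracts that form. -/
theorem quadForm_sub_smul_mulVec_le {n : Type*} [Fintype n] [DecidableEq n]
    {A : Matrix n n ℝ} (hA : A.IsHermitian) {θ r : ℝ}
    (hr : ∀ i, hA.eigenvalues i * (1 - θ * hA.eigenvalues i) ^ 2 ≤ r * hA.eigenvalues i)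
    (x : n → ℝ) :
    (x - θ • A *ᵥ x) ⬝ᵥ A *ᵥ (x - θ • A *ᵥ x) ≤ r * (x ⬝ᵥ A *ᵥ x) := by
  rw [← sum_dotProduct_eigenvectorBasis hA x, ← sum_dotProduct_eigenvectorBasis hA (x - _),
    Finset.mul_sum]
  refine Finset.sum_le_sum fun i _ => ?_
  simp only [eigenvectorBasis_dotProduct_mulVec, dotProduct_sub, dotProduct_smul, smul_eq_mul]
  nlinarith [mul_le_mul_of_nonneg_right (hr i)
    (sq_nonneg ((hA.eigenvectorBasis i).ofLp ⬝ᵥ x))]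

theorem quadForm_add_le {n : Type*} [Fintype n] {A : Matrix n n ℝ} (hA : A.IsHermitian)
    (hpos : ∀ x, 0 ≤ x ⬝ᵥ A *ᵥ x) {η : ℝ} (hη : 0 < η) (x z : n → ℝ) :
    (x + z) ⬝ᵥ A *ᵥ (x + z) ≤ (1 + η) * (x ⬝ᵥ A *ᵥ x) + (1 + 1 / η) * (z ⬝ᵥ A *ᵥ z) := by
  have h := hpos (η • x - z)
  simp only [mulVec_sub, mulVec_smul, dotProduct_sub, sub_dotProduct, smul_dotProduct,
    dotProduct_smul, smul_eq_mul, dotProduct_mulVec_comm_of_isHermitian hA z x] at h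
  simp only [mulVec_add, dotProduct_add, add_dotProduct,
    dotProduct_mulVec_comm_of_isHermitian hA z x]
  have h2 : 2 * (x ⬝ᵥ A *ᵥ z) ≤ η * (x ⬝ᵥ A *ᵥ x) + 1 / η * (z ⬝ᵥ A *ᵥ z) := by
    have : 0 ≤ (η * (η * (x ⬝ᵥ A *ᵥ x)) - 2 * η * (x ⬝ᵥ A *ᵥ z) + z ⬝ᵥ A *ᵥ z) / η :=
      div_nonneg (by linarith) hη.le
    have e : (η * (η * (x ⬝ᵥ A *ᵥ x)) - 2 * η * (x ⬝ᵥ A *ᵥ z) + z ⬝ᵥ A *ᵥ z) / η =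
        η * (x ⬝ᵥ A *ᵥ x) - 2 * (x ⬝ᵥ A *ᵥ z) + 1 / η * (z ⬝ᵥ A *ᵥ z) := by
      field_simp
    linarith
  linarith

/-- Geometric decay from an eventual contraction. -/
theorem exists_sqrt_le_geometric {V E : ℕ → ℝ} {q K : ℝ} (hq0 : 0 < q) (hq1 : q < 1)
    (hK : 0 ≤ K) (hE0 : ∀ᶠ k in atTop, 0 ≤ E k)
    (hstep : ∀ᶠ k in atTop, V (k + 1) ≤ q * V k) (hE : ∀ᶠ k in atTop, E k ≤ K * V k) :
    ∃ C > (0 : ℝ), ∃ ρ : ℝ, 0 < ρ ∧ ρ < 1 ∧ ∀ k, √(E k) ≤ C * ρ ^ k := by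
  obtain ⟨N, hN⟩ := eventually_atTop.1 (hE0.and (hstep.and hE))
  have hV : ∀ m, V (N + m) ≤ q ^ m * V N := by
    intro m
    induction m with
    | zero => simp
    | succ m ih =>
      calc V (N + (m + 1)) ≤ q * V (N + m) := (hN (N + m) (by omega)).2.1
        _ ≤ q * (q ^ m * V N) := by gcongr
        _ = q ^ (m + 1) * V N := by ring
  have hO : E =O[atTop] fun k => q ^ k := by
    refine Asymptotics.IsBigO.of_bound (K * V N / q ^ N) ?_
    filter_upwards [eventually_ge_atTop N] with k hk
    obtain ⟨m, rfl⟩ := Nat.exists_eq_add_of_le hk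
    rw [Real.norm_of_nonneg (hN _ hk).1, Real.norm_of_nonneg (by positivity)]
    calc E (N + m) ≤ K * V (N + m) := (hN _ hk).2.2
      _ ≤ K * (q ^ m * V N) := by gcongr; exact hV m
      _ = K * V N / q ^ N * q ^ (N + m) := by rw [pow_add]; field_simp
  obtain ⟨C, hC, hb⟩ := Asymptotics.bound_of_isBigO_nat_atTop hO
  refine ⟨√C, Real.sqrt_pos.2 hC, √q, Real.sqrt_pos.2 hq0,
    (Real.sqrt_lt' one_pos).2 (by simpa using hq1), fun k => ?_⟩
  refine Real.sqrt_le_iff.2 ⟨by positivity, ?_⟩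
  have h := hb (x := k) (pow_pos hq0 k).ne'
  rw [Real.norm_of_nonneg (pow_pos hq0 k).le] at h
  rw [mul_pow, Real.sq_sqrt hC.le, ← pow_mul, mul_comm k 2, pow_mul, Real.sq_sqrt hq0.le]
  exact (le_abs_self _).trans h

/-- A uniform contraction factor for step sizes close to an admissible one. -/
theorem exists_contraction_factor {ι : Type*} [Finite ι] {l : ι → ℝ} (hl : ∀ i, 0 ≤ l i)
    {θ : ℕ → ℝ} {θ₀ : ℝ} (hθ₀ : 0 < θ₀) (hsmall : θ₀ < 2 / ⨆ i, l i)
    (hθ : Tendsto θ atTop (𝓝 θ₀)) :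
    ∃ r, 0 < r ∧ r < 1 ∧ ∀ᶠ k in atTop, ∀ i, l i * (1 - θ k * l i) ^ 2 ≤ r * l i := by
  have hsup : 0 < ⨆ i, l i := by
    by_contra! h
    exact absurd (hθ₀.trans hsmall) (not_lt.2 (div_nonpos_of_nonneg_of_nonpos zero_le_two h))
  have hlt : ∀ i, 0 < l i → (1 - θ₀ * l i) ^ 2 < 1 := by
    intro i hi
    have h1 : l i ≤ ⨆ i, l i := le_ciSup (Set.finite_range l).bddAbove i
    have h2 : θ₀ * l i < 2 :=
      (mul_le_mul_of_nonneg_left h1 hθ₀.le).trans_lt ((lt_div_iff₀ hsup).1 hsmall)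
    nlinarith [mul_pos hθ₀ hi]
  have hev : ∀ᶠ r in 𝓝[<] (1 : ℝ), (∀ i, 0 < l i → (1 - θ₀ * l i) ^ 2 < r) ∧ 0 < r ∧ r < 1 := by
    refine (eventually_all.2 fun i => ?_).and
      (((eventually_gt_nhds one_pos).filter_mono nhdsWithin_le_nhds).and self_mem_nhdsWithin)
    by_cases hi : 0 < l i
    · exact ((eventually_gt_nhds (hlt i hi)).filter_mono nhdsWithin_le_nhds).mono fun r h _ => h
    · exact Eventually.of_forall fun r h => absurd h hi
  obtain ⟨r, hr, hr0, hr1⟩ := hev.exists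
  refine ⟨r, hr0, hr1, eventually_all.2 fun i => ?_⟩
  rcases (hl i).eq_or_lt with hi | hi
  · simp [← hi]
  · have ht : Tendsto (fun k => (1 - θ k * l i) ^ 2) atTop (𝓝 ((1 - θ₀ * l i) ^ 2)) :=
      (tendsto_const_nhds.sub (hθ.mul_const _)).pow 2
    filter_upwards [ht.eventually_lt_const (hr i hi)] with k hk
    nlinarith

/-- Linear convergence rate of BNGD near a minimizer: if `(a_k, w_k)` converges to a
global minimizer and the limiting effective step size satisfies `ε̂ < 2/λ*_max` (with
`λ*_max` the largest eigenvalue of `H* = H − Huuᵀ H/(uᵀHu)`), then the residuals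
`e_k = u − (w_kᵀg/σ(w_k)²)w_k` converge to `0` linearly in the `H`-norm. -/
theorem bngd_linear_convergence_rate
    {d : ℕ} (hd : 2 ≤ d)
    (H : Matrix (Fin d) (Fin d) ℝ) (hH : H.PosDef)
    (u : Fin d → ℝ) (hu : u ≠ 0)
    (εa ε : ℝ) (hεa : 0 < εa) (hε : 0 < ε)
    (g : Fin d → ℝ) (hg : g = H.mulVec u)
    (σ : (Fin d → ℝ) → ℝ) (hσ : ∀ v, σ v = Real.sqrt (v ⬝ᵥ H.mulVec v))
    (normH : (Fin d → ℝ) → ℝ) (hnormH : ∀ x, normH x = Real.sqrt (x ⬝ᵥ H.mulVec x))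
    (a : ℕ → ℝ) (w : ℕ → Fin d → ℝ) (hw0 : w 0 ≠ 0)
    (ha : ∀ k, a (k + 1) = a k + εa * ((w k ⬝ᵥ g) / σ (w k) - a k))
    (hw : ∀ k, w (k + 1) = w k +
      (ε * (a k / σ (w k))) • (g - ((w k ⬝ᵥ g) / (σ (w k)) ^ 2) • H.mulVec (w k)))
    (e : ℕ → Fin d → ℝ)
    (he : ∀ k, e k = u - ((w k ⬝ᵥ g) / (σ (w k)) ^ 2) • w k)
    (εhatseq : ℕ → ℝ)
    (hεhatseq : ∀ k, εhatseq k = ε * (a k / σ (w k)) * ((w k ⬝ᵥ g) / (σ (w k)) ^ 2))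
    (Hs : Matrix (Fin d) (Fin d) ℝ)
    (hHsdef : Hs = H - (u ⬝ᵥ H.mulVec u)⁻¹ • vecMulVec (H.mulVec u) (H.mulVec u))
    (hHs : Hs.IsHermitian)
    -- convergence to a global minimizer
    (astar : ℝ) (wstar : Fin d → ℝ) (c : ℝ) (hc : c ≠ 0) (hwstar : wstar = c • u)
    (hastar : astar = (wstar ⬝ᵥ g) / σ wstar)
    (hconva : Tendsto a atTop (nhds astar)) (hconvw : Tendsto w atTop (nhds wstar))
    -- limiting effective step size
    (εhat : ℝ) (hεhatlim : Tendsto εhatseq atTop (nhds εhat))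
    (hεhatsmall : εhat < 2 / (⨆ i, hHs.eigenvalues i)) :
    ∃ C > (0 : ℝ), ∃ ρ : ℝ, 0 < ρ ∧ ρ < 1 ∧ ∀ k, normH (e k) ≤ C * ρ ^ k := by
  have hHH := hH.isHermitian
  have hHpos : ∀ x, x ≠ 0 → 0 < x ⬝ᵥ H *ᵥ x := fun x hx => by
    simpa using hH.dotProduct_mulVec_pos hx
  have hHnonneg : ∀ x, 0 ≤ x ⬝ᵥ H *ᵥ x := fun x => by
    simpa using hH.posSemidef.dotProduct_mulVec_nonneg x
  have hS : 0 < u ⬝ᵥ g := hg ▸ hHpos u hu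
  have hHu : H *ᵥ u = g := hg.symm
  have hHsv : ∀ x, Hs *ᵥ x = H *ᵥ x - ((x ⬝ᵥ g) / (u ⬝ᵥ g)) • g := by
    intro x
    rw [hHsdef, sub_mulVec, smul_mulVec, vecMulVec_mulVec, hHu, op_smul_eq_smul, smul_smul,
      dotProduct_comm g x, div_eq_inv_mul]
  have hHsu : Hs *ᵥ u = 0 := by rw [hHsv, div_self hS.ne', hHu, one_smul, sub_self]
  have huH : ∀ x, u ⬝ᵥ H *ᵥ x = x ⬝ᵥ g := fun x => by
    rw [dotProduct_mulVec_comm_of_isHermitian hHH, hHu]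
  have hVv : ∀ x, x ⬝ᵥ Hs *ᵥ x = x ⬝ᵥ H *ᵥ x - (x ⬝ᵥ g) ^ 2 / (u ⬝ᵥ g) := by
    intro x
    rw [hHsv, dotProduct_sub, dotProduct_smul, smul_eq_mul]
    ring
  have hHspos : ∀ x, 0 ≤ x ⬝ᵥ Hs *ᵥ x := by
    intro x
    have h := hHnonneg (x - ((x ⬝ᵥ g) / (u ⬝ᵥ g)) • u)
    simp only [mulVec_sub, mulVec_smul, dotProduct_sub, sub_dotProduct, smul_dotProduct,
      dotProduct_smul, smul_eq_mul, huH, hHu] at h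
    rw [hVv]
    convert h using 1
    field_simp
    ring
  have heig : ∀ i, 0 ≤ hHs.eigenvalues i := fun i => by
    rw [hHs.eigenvalues_eq]
    simpa using hHspos (hHs.eigenvectorBasis i).ofLp
  -- limits of the scalar quantities
  have hσcont : Continuous σ := by
    rw [funext hσ]
    fun_prop
  have hσw : Tendsto (fun k => σ (w k)) atTop (𝓝 (σ wstar)) :=
    (hσcont.tendsto wstar).comp hconvw
  have hσsq : ∀ x, σ x ^ 2 = x ⬝ᵥ H *ᵥ x := fun x => by rw [hσ, Real.sq_sqrt (hHnonneg x)]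
  have hws : wstar ≠ 0 := hwstar ▸ smul_ne_zero hc hu
  have hσs : 0 < σ wstar := hσ wstar ▸ Real.sqrt_pos.2 (hHpos _ hws)
  have hwg : Tendsto (fun k => w k ⬝ᵥ g) atTop (𝓝 (wstar ⬝ᵥ g)) := by
    have : Continuous fun x : Fin d → ℝ => x ⬝ᵥ g := by fun_prop
    exact (this.tendsto wstar).comp hconvw
  have hwsg : wstar ⬝ᵥ g ≠ 0 := by
    rw [hwstar, smul_dotProduct]
    exact mul_ne_zero hc hS.ne'
  have hεpos : 0 < εhat := by
    have hlim : Tendsto εhatseq atTop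
        (𝓝 (ε * (astar / σ wstar) * ((wstar ⬝ᵥ g) / σ wstar ^ 2))) := by
      rw [funext hεhatseq]
      exact ((hconva.div hσw hσs.ne').const_mul ε).mul (hwg.div (hσw.pow 2) (by positivity))
    rw [tendsto_nhds_unique hεhatlim hlim, hastar]
    have : ε * (wstar ⬝ᵥ g / σ wstar / σ wstar) * (wstar ⬝ᵥ g / σ wstar ^ 2) =
        ε * (wstar ⬝ᵥ g) ^ 2 / σ wstar ^ 4 := by
      field_simp
    rw [this]
    have := sq_pos_of_ne_zero hwsg
    positivity
  obtain ⟨r, hr0, hr1, hr⟩ := exists_contraction_factor heig hεpos hεhatsmall hεhatlim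
  have hVlim : Tendsto (fun k => w k ⬝ᵥ Hs *ᵥ w k) atTop (𝓝 0) := by
    have hcont : Continuous fun x : Fin d → ℝ => x ⬝ᵥ Hs *ᵥ x := by fun_prop
    have h0 : wstar ⬝ᵥ Hs *ᵥ wstar = 0 := by rw [hwstar, mulVec_smul, hHsu]; simp
    exact h0 ▸ (hcont.tendsto wstar).comp hconvw
  -- one step in terms of the projected quadratic form
  have hrec : ∀ k, 0 < σ (w k) → w (k + 1) = (w k - εhatseq k • Hs *ᵥ w k) +
      (ε * (a k / σ (w k)) / σ (w k) ^ 2 * (w k ⬝ᵥ Hs *ᵥ w k)) • g := by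
    intro k hk
    have hk2 := hσsq (w k)
    rw [hw, hεhatseq, hVv, ← hk2, hHsv]
    ext i
    simp only [Pi.add_apply, Pi.sub_apply, Pi.smul_apply, smul_eq_mul]
    field_simp
    ring
  have hEV : ∀ k, 0 < σ (w k) →
      e k ⬝ᵥ H *ᵥ e k = (u ⬝ᵥ g) / σ (w k) ^ 2 * (w k ⬝ᵥ Hs *ᵥ w k) := by
    intro k hk
    have hk2 := hσsq (w k)
    rw [he, hVv]
    simp only [mulVec_sub, mulVec_smul, dotProduct_sub, sub_dotProduct, smul_dotProduct,
      dotProduct_smul, smul_eq_mul, huH, hHu, ← hk2]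
    field_simp
    ring
  set η : ℝ := (1 - r) / 4 with hη
  have hη0 : 0 < η := by rw [hη]; linarith
  have hpert : ∀ᶠ k in atTop, (1 + 1 / η) * ((ε * (a k / σ (w k)) / σ (w k) ^ 2) ^ 2 *
      (g ⬝ᵥ Hs *ᵥ g)) * (w k ⬝ᵥ Hs *ᵥ w k) < η := by
    have h1 := (((hconva.div hσw hσs.ne').const_mul ε).div (hσw.pow 2) (by positivity)).pow 2
    have h2 := (((h1.mul_const (g ⬝ᵥ Hs *ᵥ g)).const_mul (1 + 1 / η)).mul hVlim)
    rw [mul_zero] at h2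
    exact h2.eventually_lt_const hη0
  have hσev : ∀ᶠ k in atTop, σ wstar / 2 < σ (w k) :=
    hσw.eventually_const_lt (half_lt_self hσs)
  simp only [hnormH]
  refine exists_sqrt_le_geometric (V := fun k => w k ⬝ᵥ Hs *ᵥ w k) (q := (1 + η) * r + η)
    (K := (u ⬝ᵥ g) / (σ wstar / 2) ^ 2) (by positivity) (by rw [hη]; nlinarith) (by positivity)
    (Eventually.of_forall fun k => hHnonneg _) ?_ ?_
  · filter_upwards [hr, hpert, hσev] with k hk hp hs
    rw [hrec k (by linarith)]
    refine (quadForm_add_le hHs hHspos hη0 _ _).trans ?_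
    have h1 := mul_le_mul_of_nonneg_left (quadForm_sub_smul_mulVec_le hHs hk (w k))
      (by linarith : 0 ≤ 1 + η)
    have h2 := mul_le_mul_of_nonneg_right hp.le (hHspos (w k))
    simp only [mulVec_smul, smul_dotProduct, dotProduct_smul, smul_eq_mul]
    linarith
  · filter_upwards [hσev] with k hs
    have hV := hHspos (w k)
    rw [hEV k (by linarith)]
    gcongr
end
end
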